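/- arXiv:1407.2479 — 6 statements merged into one kernel-verified Lean document; each statement's English description precedes it below -/
import Mathlib

section
/- Let ε > 0 and let D₁ and D₂ be probability distributions on a measurable space Ω with densities f₁ and f₂ (with respect to a common dominating measure) satisfying (1 + ε)^{−1} ≤ f₁(ω)/f₂(ω) ≤ 1 + ε for every ω ∈ Ω. Then D_KL(D₁‖D₂) + D_KL(D₂‖D₁) ≤ ε². -/
open MeasureTheory Set

/-- The Kullback–Leibler divergence `D_KL(D₁‖D₂) = E_{ω∼D₁}[ln (f(ω)/g(ω))]` of two
distributions with densities `f` and `g` with respect to a common dominating measure `ν`. -/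
noncomputable def klDensity {Ω : Type} [MeasurableSpace Ω] (ν : Measure Ω)
    (f g : Ω → ℝ) : ℝ :=
  ∫ ω, f ω * Real.log (f ω / g ω) ∂ν

theorem kl_aux_log_bound {ε a b : ℝ} (ha : 0 < a) (hb : 0 < b)
    (h1 : a ≤ (1 + ε) * b) (h2 : b ≤ (1 + ε) * a) : |Real.log (a / b)| ≤ ε := by
  have e1 : Real.log (a / b) ≤ ε := by
    have := Real.log_le_sub_one_of_pos (div_pos ha hb)
    have h : a / b ≤ 1 + ε := (div_le_iff₀ hb).2 h1
    linarith
  have e2 : Real.log (b / a) ≤ ε := by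
    have := Real.log_le_sub_one_of_pos (div_pos hb ha)
    have h : b / a ≤ 1 + ε := (div_le_iff₀ ha).2 h2
    linarith
  have e3 : Real.log (b / a) = - Real.log (a / b) := by
    rw [← Real.log_inv, inv_div]
  rw [abs_le]
  constructor <;> linarith

theorem kl_aux_integrable {Ω : Type} [MeasurableSpace Ω] (ν : Measure Ω) (f : Ω → ℝ)
    (hm : Measurable f) (hnn : ∀ ω, 0 ≤ f ω)
    (h : IsProbabilityMeasure (ν.withDensity fun ω => ENNReal.ofReal (f ω))) :
    Integrable f ν ∧ ∫ ω, f ω ∂ν = 1 := by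
  have h1 : ∫⁻ ω, ENNReal.ofReal (f ω) ∂ν = 1 := by
    have := h.measure_univ
    rwa [withDensity_apply _ MeasurableSet.univ, Measure.restrict_univ] at this
  constructor
  · refine ⟨hm.aestronglyMeasurable, ?_⟩
    rw [hasFiniteIntegral_iff_ofReal (Filter.Eventually.of_forall hnn), h1]
    exact ENNReal.one_lt_top
  · rw [integral_eq_lintegral_of_nonneg_ae (Filter.Eventually.of_forall hnn)
      hm.aestronglyMeasurable, h1, ENNReal.toReal_one]

/-- If two distributions `D₁ = f₁ dν` and `D₂ = f₂ dν` satisfy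
`(1+ε)⁻¹ ≤ f₁(ω)/f₂(ω) ≤ 1+ε` for every `ω`, then
`D_KL(D₁‖D₂) + D_KL(D₂‖D₁) ≤ ε²`. -/
theorem kl_divergence_of_close_densities {Ω : Type} [MeasurableSpace Ω] (ν : Measure Ω)
    (ε : ℝ) (hε : 0 < ε) (f₁ f₂ : Ω → ℝ)
    (hm₁ : Measurable f₁) (hm₂ : Measurable f₂)
    (hnn₁ : ∀ ω, 0 ≤ f₁ ω) (hnn₂ : ∀ ω, 0 ≤ f₂ ω)
    (h₁ : IsProbabilityMeasure (ν.withDensity fun ω => ENNReal.ofReal (f₁ ω)))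
    (h₂ : IsProbabilityMeasure (ν.withDensity fun ω => ENNReal.ofReal (f₂ ω)))
    (hratio : ∀ ω, (1 + ε)⁻¹ ≤ f₁ ω / f₂ ω ∧ f₁ ω / f₂ ω ≤ 1 + ε) :
    klDensity ν f₁ f₂ + klDensity ν f₂ f₁ ≤ ε ^ 2 := by
  have hpos : ∀ ω, 0 < f₁ ω ∧ 0 < f₂ ω := by
    intro ω
    have h0 : 0 < f₁ ω / f₂ ω := lt_of_lt_of_le (by positivity) (hratio ω).1
    constructor
    · refine lt_of_le_of_ne (hnn₁ ω) fun h => ?_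
      rw [← h, zero_div] at h0
      exact lt_irrefl _ h0
    · refine lt_of_le_of_ne (hnn₂ ω) fun h => ?_
      rw [← h, div_zero] at h0
      exact lt_irrefl _ h0
  have hb1 : ∀ ω, f₁ ω ≤ (1 + ε) * f₂ ω := fun ω =>
    (div_le_iff₀ (hpos ω).2).1 (hratio ω).2
  have hb2 : ∀ ω, f₂ ω ≤ (1 + ε) * f₁ ω := fun ω => by
    have := (le_div_iff₀ (hpos ω).2).1 (hratio ω).1
    rwa [inv_mul_le_iff₀ (by positivity)] at this
  have hl1 := fun ω => kl_aux_log_bound (hpos ω).1 (hpos ω).2 (hb1 ω) (hb2 ω)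
  have hl2 := fun ω => kl_aux_log_bound (hpos ω).2 (hpos ω).1 (hb2 ω) (hb1 ω)
  obtain ⟨i1, s1⟩ := kl_aux_integrable ν f₁ hm₁ hnn₁ h₁
  obtain ⟨i2, s2⟩ := kl_aux_integrable ν f₂ hm₂ hnn₂ h₂
  have j1 : Integrable (fun ω => f₁ ω * Real.log (f₁ ω / f₂ ω)) ν :=
    i1.mul_bdd (c := ε) (hm₁.div hm₂).log.aestronglyMeasurable
      (Filter.Eventually.of_forall hl1)
  have j2 : Integrable (fun ω => f₂ ω * Real.log (f₂ ω / f₁ ω)) ν :=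
    i2.mul_bdd (c := ε) (hm₂.div hm₁).log.aestronglyMeasurable
      (Filter.Eventually.of_forall hl2)
  unfold klDensity
  rw [← integral_add j1 j2]
  have hR : ∫ ω, ε ^ 2 * f₁ ω ∂ν = ε ^ 2 := by
    rw [integral_const_mul, s1, mul_one]
  rw [← hR]
  refine integral_mono (j1.add j2) (i1.const_mul _) fun ω => ?_
  have e3 : Real.log (f₂ ω / f₁ ω) = - Real.log (f₁ ω / f₂ ω) := by
    rw [← Real.log_inv, inv_div]
  have hd : |f₁ ω - f₂ ω| ≤ ε * f₁ ω := by
    rw [abs_le]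
    constructor
    · linarith [hb2 ω]
    · rcases le_total (f₁ ω) (f₂ ω) with h | h
      · have := mul_nonneg hε.le (hnn₁ ω)
        linarith
      · have := mul_le_mul_of_nonneg_left h hε.le
        linarith [hb1 ω]
  calc f₁ ω * Real.log (f₁ ω / f₂ ω) + f₂ ω * Real.log (f₂ ω / f₁ ω)
      = (f₁ ω - f₂ ω) * Real.log (f₁ ω / f₂ ω) := by rw [e3]; ring
    _ ≤ |f₁ ω - f₂ ω| * |Real.log (f₁ ω / f₂ ω)| := by
        rw [← abs_mul]; exact le_abs_self _
    _ ≤ (ε * f₁ ω) * ε := mul_le_mul hd (hl1 ω) (abs_nonneg _)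
        (mul_nonneg hε.le (hnn₁ ω))
    _ = ε ^ 2 * f₁ ω := by ring
end

section
/- Let ε > 0 and let D₁ and D₂ be probability distributions on a measurable space Ω with densities f₁ and f₂ (with respect to a common dominating measure) satisfying (1 + ε)^{−1} ≤ f₁(ω)/f₂(ω) ≤ 1 + ε for every ω ∈ Ω. Suppose in addition there is a measurable subset Ω' ⊆ Ω with f₁(ω) = f₂(ω) for every ω ∈ Ω'. Then D_KL(D₁‖D₂) + D_KL(D₂‖D₁) ≤ ε² · (1 − D₁(Ω')). -/
open MeasureTheory Set

/-- If two distributions `D₁ = f₁ dν` and `D₂ = f₂ dν` satisfy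
`(1+ε)⁻¹ ≤ f₁(ω)/f₂(ω) ≤ 1+ε` for every `ω`, and moreover `f₁ = f₂` on a measurable
subset `Ω'`, then `D_KL(D₁‖D₂) + D_KL(D₂‖D₁) ≤ ε² (1 - D₁(Ω'))`. -/
theorem kl_divergence_of_close_densities_partial_eq {Ω : Type} [MeasurableSpace Ω]
    (ν : Measure Ω)
    (ε : ℝ) (hε : 0 < ε) (f₁ f₂ : Ω → ℝ)
    (hm₁ : Measurable f₁) (hm₂ : Measurable f₂)
    (hnn₁ : ∀ ω, 0 ≤ f₁ ω) (hnn₂ : ∀ ω, 0 ≤ f₂ ω)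
    (h₁ : IsProbabilityMeasure (ν.withDensity fun ω => ENNReal.ofReal (f₁ ω)))
    (h₂ : IsProbabilityMeasure (ν.withDensity fun ω => ENNReal.ofReal (f₂ ω)))
    (hratio : ∀ ω, (1 + ε)⁻¹ ≤ f₁ ω / f₂ ω ∧ f₁ ω / f₂ ω ≤ 1 + ε)
    (Ω' : Set Ω) (hΩ' : MeasurableSet Ω') (heq : ∀ ω ∈ Ω', f₁ ω = f₂ ω) :
    klDensity ν f₁ f₂ + klDensity ν f₂ f₁ ≤
      ε ^ 2 * (1 - ((ν.withDensity fun ω => ENNReal.ofReal (f₁ ω)) Ω').toReal) := by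
  unfold klDensity
  have hpos : ∀ ω, 0 < f₁ ω ∧ 0 < f₂ ω := by
    intro ω
    have h := lt_of_lt_of_le (inv_pos.mpr (by linarith : (0:ℝ) < 1 + ε)) (hratio ω).1
    constructor
    · rcases (hnn₁ ω).lt_or_eq with h' | h'
      · exact h'
      · rw [← h'] at h; simp at h
    · rcases (hnn₂ ω).lt_or_eq with h' | h'
      · exact h'
      · rw [← h'] at h; simp at h
  have hint : ∀ f : Ω → ℝ, Measurable f → (∀ ω, 0 ≤ f ω) →
      IsProbabilityMeasure (ν.withDensity fun ω => ENNReal.ofReal (f ω)) →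
      Integrable f ν ∧ ∫ ω, f ω ∂ν = 1 := by
    intro f hm hnn hp
    have h := hp.measure_univ
    rw [withDensity_apply _ MeasurableSet.univ, Measure.restrict_univ] at h
    constructor
    · refine ⟨hm.aestronglyMeasurable, ?_⟩
      rw [hasFiniteIntegral_iff_ofReal (Filter.Eventually.of_forall hnn), h]
      simp
    · rw [integral_eq_lintegral_of_nonneg_ae (Filter.Eventually.of_forall hnn)
        hm.aestronglyMeasurable, h]
      simp
  obtain ⟨i₁, e₁⟩ := hint f₁ hm₁ hnn₁ h₁
  obtain ⟨i₂, e₂⟩ := hint f₂ hm₂ hnn₂ h₂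
  have hD : ((ν.withDensity fun ω => ENNReal.ofReal (f₁ ω)) Ω').toReal
      = ∫ ω in Ω', f₁ ω ∂ν := by
    rw [withDensity_apply _ hΩ', integral_eq_lintegral_of_nonneg_ae
      (Filter.Eventually.of_forall hnn₁) hm₁.aestronglyMeasurable]
  have hlog1 : Real.log (1 + ε) ≤ ε := by
    have := Real.log_le_sub_one_of_pos (by linarith : (0:ℝ) < 1 + ε)
    linarith
  have hlog : ∀ ω, |Real.log (f₁ ω / f₂ ω)| ≤ ε := by
    intro ω
    obtain ⟨a, b⟩ := hpos ω
    have hr : 0 < f₁ ω / f₂ ω := div_pos a b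
    rw [abs_le]
    constructor
    · have := Real.log_le_log (inv_pos.mpr (by linarith : (0:ℝ) < 1 + ε)) (hratio ω).1
      rw [Real.log_inv] at this
      linarith
    · exact (Real.log_le_log hr (hratio ω).2).trans hlog1
  have hswap : ∀ ω, Real.log (f₂ ω / f₁ ω) = - Real.log (f₁ ω / f₂ ω) := by
    intro ω
    rw [← Real.log_inv, inv_div]
  have j₁ : Integrable (fun ω => f₁ ω * Real.log (f₁ ω / f₂ ω)) ν :=
    i₁.mul_bdd (c := ε) (Real.measurable_log.comp (hm₁.div hm₂)).aestronglyMeasurable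
      (Filter.Eventually.of_forall hlog)
  have j₂ : Integrable (fun ω => f₂ ω * Real.log (f₂ ω / f₁ ω)) ν :=
    i₂.mul_bdd (c := ε) (Real.measurable_log.comp (hm₂.div hm₁)).aestronglyMeasurable
      (Filter.Eventually.of_forall fun ω => by
        change ‖Real.log (f₂ ω / f₁ ω)‖ ≤ ε
        rw [hswap, norm_neg]; exact hlog ω)
  rw [← integral_add j₁ j₂, hD]
  have hc : 1 - ∫ ω in Ω', f₁ ω ∂ν = ∫ ω, Ω'ᶜ.indicator f₁ ω ∂ν := by
    rw [integral_indicator hΩ'.compl, ← e₁, ← integral_add_compl hΩ' i₁]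
    ring
  rw [hc, ← integral_const_mul]
  refine integral_mono (j₁.add j₂) ((i₁.indicator hΩ'.compl).const_mul _) ?_
  intro ω
  beta_reduce
  rw [hswap]
  by_cases hω : ω ∈ Ω'
  · simp [hω, heq ω hω]
  · rw [indicator_of_mem (by exact hω)]
    obtain ⟨a, b⟩ := hpos ω
    have hd : |f₁ ω - f₂ ω| ≤ ε * f₁ ω := by
      obtain ⟨l, u⟩ := hratio ω
      rw [div_le_iff₀ b] at u
      rw [le_div_iff₀ b, inv_mul_le_iff₀ (by linarith)] at l
      rw [abs_le]
      constructor
      · linarith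
      · by_contra! hcon
        have : f₂ ω < f₁ ω := by nlinarith
        nlinarith
    calc f₁ ω * Real.log (f₁ ω / f₂ ω) + f₂ ω * -Real.log (f₁ ω / f₂ ω)
        = (f₁ ω - f₂ ω) * Real.log (f₁ ω / f₂ ω) := by ring
      _ ≤ |f₁ ω - f₂ ω| * |Real.log (f₁ ω / f₂ ω)| := by
        rw [← abs_mul]; exact le_abs_self _
      _ ≤ (ε * f₁ ω) * ε := by
        gcongr
        exact hlog ω
      _ = ε ^ 2 * f₁ ω := by ring
end

section
/- Let ε, ε' > 0 and let D₁ and D₂ be probability distributions on a measurable space Ω with densities f₁ and f₂ (with respect to a common dominating measure) satisfying (1 + ε)^{−1} ≤ f₁(ω)/f₂(ω) ≤ 1 + ε for every ω ∈ Ω, and moreover (1 + ε')^{−1} ≤ f₁(ω)/f₂(ω) ≤ 1 + ε' for every ω in a measurable subset Ω' ⊆ Ω. Then D_KL(D₁‖D₂) + D_KL(D₂‖D₁) ≤ ε² · D₁(Ω ∖ Ω') + (ε')² · D₁(Ω'). -/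
open MeasureTheory Set

theorem aux_pt (ε a b : ℝ) (hε : 0 < ε) (ha : 0 ≤ a) (hb : 0 ≤ b)
    (h : (1 + ε)⁻¹ ≤ a / b ∧ a / b ≤ 1 + ε) :
    0 < a ∧ 0 < b ∧ |Real.log (a / b)| ≤ ε ∧ |Real.log (b / a)| ≤ ε ∧
      a * Real.log (a / b) + b * Real.log (b / a) ≤ ε ^ 2 * a := by
  obtain ⟨hl, hu⟩ := h
  have hp : (0:ℝ) < 1 + ε := by linarith
  have hr : 0 < a / b := lt_of_lt_of_le (inv_pos.mpr hp) hl
  have hb0 : 0 < b := by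
    rcases hb.eq_or_lt with h | h
    · rw [← h] at hr; simp at hr
    · exact h
  have ha0 : 0 < a := by
    rcases ha.eq_or_lt with h | h
    · rw [← h] at hr; simp at hr
    · exact h
  have hlog : Real.log (1 + ε) ≤ ε := by
    have := Real.log_le_sub_one_of_pos hp
    linarith
  have h1 : Real.log (a / b) ≤ ε := (Real.log_le_log hr hu).trans hlog
  have h2 : -ε ≤ Real.log (a / b) := by
    have := Real.log_le_log (inv_pos.mpr hp) hl
    rw [Real.log_inv] at this
    linarith
  have h3 : Real.log (b / a) = - Real.log (a / b) := by
    rw [← Real.log_inv, inv_div]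
  have habs : |Real.log (a / b)| ≤ ε := abs_le.mpr ⟨h2, h1⟩
  refine ⟨ha0, hb0, habs, by rw [h3, abs_neg]; exact habs, ?_⟩
  have hab : a ≤ (1 + ε) * b := (div_le_iff₀ hb0).mp hu
  have hba : b ≤ (1 + ε) * a := by
    rw [inv_le_comm₀ hp hr, inv_div] at hl
    exact (div_le_iff₀ ha0).mp hl
  have hd : |a - b| ≤ ε * a := by
    rw [abs_le]
    constructor
    · linarith
    · by_cases hc : a ≤ b
      · have := mul_pos hε ha0
        linarith
      · push Not at hc
        nlinarith
  calc a * Real.log (a / b) + b * Real.log (b / a) = (a - b) * Real.log (a / b) := by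
        rw [h3]; ring
    _ ≤ |(a - b) * Real.log (a / b)| := le_abs_self _
    _ = |a - b| * |Real.log (a / b)| := abs_mul _ _
    _ ≤ (ε * a) * ε := mul_le_mul hd habs (abs_nonneg _) (by positivity)
    _ = ε ^ 2 * a := by ring

theorem aux_int {Ω : Type} [MeasurableSpace Ω] (ν : Measure Ω) (f : Ω → ℝ)
    (hm : Measurable f) (hnn : ∀ ω, 0 ≤ f ω)
    (h : IsProbabilityMeasure (ν.withDensity fun ω => ENNReal.ofReal (f ω))) :
    Integrable f ν := by
  refine ⟨hm.aestronglyMeasurable, ?_⟩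
  rw [hasFiniteIntegral_iff_ofReal (Filter.Eventually.of_forall hnn)]
  have := h.measure_univ
  rw [withDensity_apply _ MeasurableSet.univ, setLIntegral_univ] at this
  rw [this]; exact ENNReal.one_lt_top

theorem aux_set {Ω : Type} [MeasurableSpace Ω] (ν : Measure Ω) (f : Ω → ℝ)
    (hm : Measurable f) (hnn : ∀ ω, 0 ≤ f ω) (s : Set Ω) (hs : MeasurableSet s) :
    ((ν.withDensity fun ω => ENNReal.ofReal (f ω)) s).toReal = ∫ ω in s, f ω ∂ν := by
  rw [withDensity_apply _ hs, integral_eq_lintegral_of_nonneg_ae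
    (Filter.Eventually.of_forall hnn) hm.aestronglyMeasurable]

/-- If two distributions `D₁ = f₁ dν` and `D₂ = f₂ dν` satisfy
`(1+ε)⁻¹ ≤ f₁(ω)/f₂(ω) ≤ 1+ε` everywhere and `(1+ε')⁻¹ ≤ f₁(ω)/f₂(ω) ≤ 1+ε'` on a
measurable subset `Ω'`, then
`D_KL(D₁‖D₂) + D_KL(D₂‖D₁) ≤ ε² D₁(Ω \ Ω') + ε'² D₁(Ω')`. -/
theorem kl_divergence_of_close_densities_two_scales {Ω : Type} [MeasurableSpace Ω]
    (ν : Measure Ω)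
    (ε ε' : ℝ) (hε : 0 < ε) (hε' : 0 < ε') (f₁ f₂ : Ω → ℝ)
    (hm₁ : Measurable f₁) (hm₂ : Measurable f₂)
    (hnn₁ : ∀ ω, 0 ≤ f₁ ω) (hnn₂ : ∀ ω, 0 ≤ f₂ ω)
    (h₁ : IsProbabilityMeasure (ν.withDensity fun ω => ENNReal.ofReal (f₁ ω)))
    (h₂ : IsProbabilityMeasure (ν.withDensity fun ω => ENNReal.ofReal (f₂ ω)))
    (hratio : ∀ ω, (1 + ε)⁻¹ ≤ f₁ ω / f₂ ω ∧ f₁ ω / f₂ ω ≤ 1 + ε)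
    (Ω' : Set Ω) (hΩ' : MeasurableSet Ω')
    (hratio' : ∀ ω ∈ Ω', (1 + ε')⁻¹ ≤ f₁ ω / f₂ ω ∧ f₁ ω / f₂ ω ≤ 1 + ε') :
    klDensity ν f₁ f₂ + klDensity ν f₂ f₁ ≤
      ε ^ 2 * ((ν.withDensity fun ω => ENNReal.ofReal (f₁ ω)) Ω'ᶜ).toReal
        + ε' ^ 2 * ((ν.withDensity fun ω => ENNReal.ofReal (f₁ ω)) Ω').toReal := by
  have P := fun ω => aux_pt ε (f₁ ω) (f₂ ω) hε (hnn₁ ω) (hnn₂ ω) (hratio ω)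
  have i1 := aux_int ν f₁ hm₁ hnn₁ h₁
  have i2 := aux_int ν f₂ hm₂ hnn₂ h₂
  have j1 : Integrable (fun ω => f₁ ω * Real.log (f₁ ω / f₂ ω)) ν :=
    i1.mul_bdd (c := ε) (hm₁.div hm₂).log.aestronglyMeasurable
      (Filter.Eventually.of_forall fun ω => (P ω).2.2.1)
  have j2 : Integrable (fun ω => f₂ ω * Real.log (f₂ ω / f₁ ω)) ν :=
    i2.mul_bdd (c := ε) (hm₂.div hm₁).log.aestronglyMeasurable
      (Filter.Eventually.of_forall fun ω => (P ω).2.2.2.1)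
  have j : Integrable (fun ω => f₁ ω * Real.log (f₁ ω / f₂ ω)
      + f₂ ω * Real.log (f₂ ω / f₁ ω)) ν := j1.add j2
  rw [aux_set ν f₁ hm₁ hnn₁ _ hΩ'.compl, aux_set ν f₁ hm₁ hnn₁ _ hΩ']
  unfold klDensity
  rw [← integral_add j1 j2, ← integral_add_compl hΩ' j,
    add_comm (∫ ω in Ω', _ ∂ν) (∫ ω in Ω'ᶜ, _ ∂ν),
    ← integral_const_mul, ← integral_const_mul]
  refine add_le_add ?_ ?_
  · exact setIntegral_mono_on j.integrableOn (i1.const_mul _).integrableOn hΩ'.compl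
      fun ω _ => (P ω).2.2.2.2
  · exact setIntegral_mono_on j.integrableOn (i1.const_mul _).integrableOn hΩ'
      fun ω hω => (aux_pt ε' (f₁ ω) (f₂ ω) hε' (hnn₁ ω) (hnn₂ ω) (hratio' ω hω)).2.2.2.2
end

section
/- There exist constants c > 0 and ε₀ ∈ (0,1) such that for every H ≥ 2 and every ε ∈ (0, ε₀): every (possibly randomized) m-sample pricing strategy that is (1 − ε)-approximate for every value distribution with support contained in [1, H] satisfies m ≥ c·H·ε^{−2}. -/
open MeasureTheory Set

/-- The CDF of a distribution on `ℝ`. -/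
noncomputable def cdf (D : Measure ℝ) (x : ℝ) : ℝ := (D (Iic x)).toReal

/-- The expected revenue of a randomized `m`-sample pricing strategy `strat` (whose
internal randomness is drawn from the probability space `(Ω, P)`) against the value
distribution `μ`. -/
noncomputable def expRevenue {m : ℕ} {Ω : Type} [MeasurableSpace Ω]
    (μ : Measure ℝ) (P : Measure Ω) (strat : (Fin m → ℝ) → Ω → ℝ) : ℝ :=
  ∫ x, strat x.1 x.2 * (1 - cdf μ (strat x.1 x.2))
    ∂((Measure.pi fun _ : Fin m => μ).prod P)


noncomputable def bern (q : ℝ) : Measure Bool :=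
  ENNReal.ofReal (1 - q) • Measure.dirac false + ENNReal.ofReal q • Measure.dirac true

def gval (H : ℝ) (b : Bool) : ℝ := if b then H else 1

def wt (q : ℝ) (b : Bool) : ℝ := if b then q else 1 - q

noncomputable def twoPt (H q : ℝ) : Measure ℝ := (bern q).map (gval H)

lemma bern_prob {q : ℝ} (h0 : 0 ≤ q) (h1 : q ≤ 1) : IsProbabilityMeasure (bern q) := by
  constructor
  simp only [bern, Measure.add_apply, Measure.smul_apply, measure_univ, smul_eq_mul, mul_one]
  rw [← ENNReal.ofReal_add (by linarith) h0]
  simp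

lemma bern_real {q : ℝ} (h0 : 0 ≤ q) (h1 : q ≤ 1) (b : Bool) : (bern q).real {b} = wt q b := by
  cases b <;> simp [bern, Measure.real, wt, h0, h1]

lemma twoPt_prob {H q : ℝ} (h0 : 0 ≤ q) (h1 : q ≤ 1) : IsProbabilityMeasure (twoPt H q) := by
  have := bern_prob h0 h1
  exact Measure.isProbabilityMeasure_map (measurable_of_countable _).aemeasurable

lemma twoPt_apply (H q : ℝ) {s : Set ℝ} (hs : MeasurableSet s) :
    twoPt H q s = ENNReal.ofReal (1 - q) * s.indicator 1 1 + ENNReal.ofReal q * s.indicator 1 H := by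
  rw [twoPt, Measure.map_apply (measurable_of_countable _) hs]
  have a : (false ∈ gval H ⁻¹' s) ↔ (1 ∈ s) := by simp [gval]
  have b : (true ∈ gval H ⁻¹' s) ↔ (H ∈ s) := by simp [gval]
  simp [bern, Set.indicator]
  congr 1

lemma twoPt_cdf {H q : ℝ} (h0 : 0 ≤ q) (h1 : q ≤ 1) (hH : 2 ≤ H) (x : ℝ) :
    cdf (twoPt H q) x = if x < 1 then 0 else if x < H then 1 - q else 1 := by
  rw [cdf, twoPt_apply _ _ measurableSet_Iic]
  split_ifs with h2 h3
  · have a : ¬ (1 ≤ x) := by linarith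
    have b : ¬ (H ≤ x) := by linarith
    simp [Set.indicator, a, b]
  · have a : (1 ≤ x) := by linarith
    have b : ¬ (H ≤ x) := by linarith
    simp [Set.indicator, a, b, h1]
  · have a : (1 ≤ x) := by linarith
    have b : (H ≤ x) := by linarith
    simp only [Set.indicator, mem_Iic, a, b, if_true, Pi.one_apply, mul_one]
    rw [← ENNReal.ofReal_add (by linarith) h0]
    simp

lemma integral_twoPt {H q : ℝ} (h0 : 0 ≤ q) (h1 : q ≤ 1) {m : ℕ} (h : (Fin m → ℝ) → ℝ)
    (hm : Measurable h) :
    ∫ x, h x ∂(Measure.pi fun _ : Fin m => twoPt H q) =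
      ∑ b : Fin m → Bool, (∏ i, wt q (b i)) * h (fun i => gval H (b i)) := by
  have := bern_prob h0 h1
  have := twoPt_prob (H := H) h0 h1
  have e : (Measure.pi fun _ : Fin m => twoPt H q) =
      (Measure.pi fun _ : Fin m => bern q).map (fun x i => gval H (x i)) := by
    unfold twoPt
    symm
    have : ∀ i : Fin m, SigmaFinite ((bern q).map (gval H)) := fun _ => by
      have := twoPt_prob (H := H) h0 h1
      unfold twoPt at this
      infer_instance
    exact (Measure.pi_map_pi (fun i => (measurable_of_countable _).aemeasurable))
  rw [e, integral_map (measurable_of_countable _).aemeasurable hm.aestronglyMeasurable,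
    integral_fintype (Integrable.of_finite)]
  refine Finset.sum_congr rfl fun b _ => ?_
  rw [smul_eq_mul]
  congr 1
  rw [Measure.real, Measure.pi_singleton, ENNReal.toReal_prod]
  exact Finset.prod_congr rfl fun i _ => bern_real h0 h1 (b i)

lemma expRev_le {H q : ℝ} (h0 : 0 ≤ q) (h1 : q ≤ 1) (hH : 2 ≤ H) {m : ℕ} {Ω : Type}
    [MeasurableSpace Ω] (P : Measure Ω) [IsProbabilityMeasure P] (strat : (Fin m → ℝ) → Ω → ℝ)
    (hs : Measurable fun x : (Fin m → ℝ) × Ω => strat x.1 x.2) :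
    expRevenue (twoPt H q) P strat ≤ H * q + (1 - H * q) *
      ∑ b : Fin m → Bool, (∏ i, wt q (b i)) *
        P.real {ω | strat (fun i => gval H (b i)) ω < 1} := by
  have := twoPt_prob (H := H) h0 h1
  set A : Set ((Fin m → ℝ) × Ω) := {x | strat x.1 x.2 < 1} with hA
  have hAm : MeasurableSet A := measurableSet_lt hs measurable_const
  set M := (Measure.pi fun _ : Fin m => twoPt H q).prod P
  have hi : Integrable (A.indicator (fun _ => (1:ℝ))) M := (integrable_const 1).indicator hAm
  have hHq : 0 ≤ H * q := by positivity
  have key : expRevenue (twoPt H q) P strat ≤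
      ∫ x, (H * q + (1 - H * q) * A.indicator (fun _ => (1:ℝ)) x) ∂M := by
    unfold expRevenue
    by_cases hint : Integrable (fun x : (Fin m → ℝ) × Ω =>
        strat x.1 x.2 * (1 - cdf (twoPt H q) (strat x.1 x.2))) M
    · refine integral_mono hint ((integrable_const _).add (hi.const_mul _)) fun x => ?_
      simp only [twoPt_cdf h0 h1 hH, Set.indicator, hA, mem_setOf_eq]
      split_ifs with a b
      · linarith
      · nlinarith
      · linarith
    · rw [integral_undef hint]
      refine integral_nonneg fun x => ?_
      simp only [Set.indicator, Pi.zero_apply]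
      split_ifs <;> linarith
  refine key.trans_eq ?_
  rw [integral_add (integrable_const _) (hi.const_mul _), integral_const_mul (1 - H * q)]
  have e : ∫ x, A.indicator (fun _ => (1:ℝ)) x ∂M = ∑ b : Fin m → Bool, (∏ i, wt q (b i)) *
        P.real {ω | strat (fun i => gval H (b i)) ω < 1} := by
    rw [integral_prod _ hi]
    have e2 : ∀ x : Fin m → ℝ, ∫ y, A.indicator (fun _ => (1:ℝ)) (x, y) ∂P =
        P.real {ω | strat x ω < 1} := by
      intro x
      have : MeasurableSet {ω | strat x ω < 1} := measurable_prodMk_left hAm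
      rw [← integral_indicator_one this]
      rfl
    simp_rw [e2]
    refine integral_twoPt h0 h1 _ ?_
    exact (measurable_measure_prodMk_left hAm).ennreal_toReal
  rw [e]
  simp

lemma sum_wt_prod (f : Bool → ℝ) (m : ℕ) :
    ∑ b : Fin m → Bool, ∏ i, f (b i) = (f true + f false) ^ m := by
  have := (Fintype.sum_pow f m).symm
  simpa using this

/-- chi-square bound -/
lemma chi {q p : ℝ} (h0 : 0 < q) (h1 : q < 1) {m : ℕ} (a : (Fin m → Bool) → ℝ)
    (ha0 : ∀ b, 0 ≤ a b) (ha1 : ∀ b, a b ≤ 1) :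
    (∑ b : Fin m → Bool, (∏ i, wt p (b i)) * a b - ∑ b : Fin m → Bool, (∏ i, wt q (b i)) * a b) ^ 2
      ≤ (1 + (p - q) ^ 2 / (q * (1 - q))) ^ m - 1 := by
  have hw : ∀ b, 0 < wt q b := by intro b; cases b <;> simp [wt, h0, h1]
  have hW : ∀ b : Fin m → Bool, 0 < ∏ i, wt q (b i) := fun b => Finset.prod_pos fun i _ => hw _
  have s1 : ∑ b : Fin m → Bool, ∏ i, wt q (b i) = 1 := by
    rw [sum_wt_prod]; simp [wt]
  have s2 : ∑ b : Fin m → Bool, ∏ i, wt p (b i) = 1 := by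
    rw [sum_wt_prod]; simp [wt]
  have s3 : ∑ b : Fin m → Bool, (∏ i, wt p (b i)) ^ 2 / ∏ i, wt q (b i) =
      (1 + (p - q) ^ 2 / (q * (1 - q))) ^ m := by
    have : ∀ b : Fin m → Bool, (∏ i, wt p (b i)) ^ 2 / ∏ i, wt q (b i) =
        ∏ i, (fun c => wt p c ^ 2 / wt q c) (b i) := by
      intro b
      simp [Finset.prod_div_distrib, Finset.prod_pow]
    simp_rw [this]
    rw [sum_wt_prod (fun c => wt p c ^ 2 / wt q c)]
    congr 1
    have : 1 - q ≠ 0 := by linarith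
    have : q ≠ 0 := by linarith
    simp only [wt, if_true, Bool.false_eq_true, if_false]
    field_simp
    ring
  have s4 : ∑ b : Fin m → Bool, (∏ i, wt p (b i) - ∏ i, wt q (b i)) ^ 2 / ∏ i, wt q (b i) =
      (1 + (p - q) ^ 2 / (q * (1 - q))) ^ m - 1 := by
    have : ∀ b : Fin m → Bool, (∏ i, wt p (b i) - ∏ i, wt q (b i)) ^ 2 / ∏ i, wt q (b i) =
        (∏ i, wt p (b i)) ^ 2 / ∏ i, wt q (b i) - 2 * (∏ i, wt p (b i)) + ∏ i, wt q (b i) := by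
      intro b
      have := (hW b).ne'
      field_simp
      ring
    simp_rw [this]
    rw [Finset.sum_add_distrib, Finset.sum_sub_distrib, ← Finset.mul_sum, s1, s2, s3]
    ring
  have cs := Finset.sum_sq_le_sum_mul_sum_of_sq_le_mul Finset.univ
    (r := fun b : Fin m → Bool => (∏ i, wt p (b i) - ∏ i, wt q (b i)) * a b)
    (f := fun b => (∏ i, wt p (b i) - ∏ i, wt q (b i)) ^ 2 / ∏ i, wt q (b i))
    (g := fun b => ∏ i, wt q (b i))
    (fun b _ => div_nonneg (sq_nonneg _) (hW b).le) (fun b _ => (hW b).le)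
    (fun b _ => by
      rw [div_mul_cancel₀ _ (hW b).ne', mul_pow]
      have : a b ^ 2 ≤ 1 := pow_le_one₀ (ha0 b) (ha1 b)
      exact mul_le_of_le_one_right (sq_nonneg _) this)
  rw [s1, s4, mul_one] at cs
  rw [← Finset.sum_sub_distrib]
  simpa only [sub_mul] using cs

lemma twoPt_supp {H q : ℝ} (hH : 2 ≤ H) : twoPt H q ((Icc (1:ℝ) H)ᶜ) = 0 := by
  rw [twoPt_apply _ _ measurableSet_Icc.compl]
  have : (1:ℝ) ≤ H := by linarith
  simp [Set.indicator, this]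

lemma approx_ge {H q ε E : ℝ} (h0 : 0 ≤ q) (h1 : q ≤ 1) (hH : 2 ≤ H) (he : ε < 1)
    (h : ∀ r : ℝ, (1 - ε) * (r * (1 - cdf (twoPt H q) r)) ≤ E) :
    (1 - ε) ≤ E ∧ (1 - ε) * (H * q) ≤ E := by
  have lim : ∀ (t c : ℝ), 1 ≤ t → 0 ≤ c → (∀ r, t - 1 / 2 ≤ r → r < t → c * r ≤ E) → c * t ≤ E := by
    intro t c ht hc hr
    have : Filter.Tendsto (fun r => c * r) (nhdsWithin t (Iio t)) (nhds (c * t)) :=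
      (continuous_const.mul continuous_id).continuousAt.continuousWithinAt
    refine le_of_tendsto this ?_
    filter_upwards [Ico_mem_nhdsLT (show t - 1 / 2 < t by linarith)] with r hr'
    exact hr r hr'.1 hr'.2
  constructor
  · have := lim 1 (1 - ε) le_rfl (by linarith) (fun r _ hr => by
      have := h r
      rw [twoPt_cdf h0 h1 hH, if_pos hr] at this
      linarith)
    linarith
  · have := lim H ((1 - ε) * q) (by linarith) (mul_nonneg (by linarith) h0) (fun r hr' hr => by
      have := h r
      rw [twoPt_cdf h0 h1 hH, if_neg (by linarith), if_pos hr] at this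
      linarith)
    linarith

/-- There are constants `c > 0` and `ε₀ ∈ (0,1)` such that for every `H ≥ 2` and every
`ε ∈ (0,ε₀)`, every (possibly randomized) `m`-sample pricing strategy that is
`(1-ε)`-approximate for every value distribution with support contained in `[1,H]`
satisfies `m ≥ c H ε⁻²`. -/
theorem bounded_support_sample_complexity_lower_bound :
    ∃ c ε₀ : ℝ, 0 < c ∧ ε₀ ∈ Ioo (0:ℝ) 1 ∧
      ∀ H : ℝ, 2 ≤ H →
      ∀ ε : ℝ, ε ∈ Ioo (0:ℝ) ε₀ →
      ∀ (m : ℕ) (Ω : Type) [MeasurableSpace Ω] (P : Measure Ω),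
        IsProbabilityMeasure P →
      ∀ strat : (Fin m → ℝ) → Ω → ℝ,
        (Measurable fun x : (Fin m → ℝ) × Ω => strat x.1 x.2) →
        (∀ D : Measure ℝ, IsProbabilityMeasure D → D ((Icc (1:ℝ) H)ᶜ) = 0 →
          ∀ r : ℝ, (1 - ε) * (r * (1 - cdf D r)) ≤ expRevenue D P strat) →
        c * H * ε⁻¹ ^ 2 ≤ (m : ℝ) := by
  refine ⟨1 / 2000, 1 / 16, by norm_num, by constructor <;> norm_num, ?_⟩
  intro H hH ε ⟨he0, he1⟩ m Ω _ P hP strat hs happ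
  have hH0 : 0 < H := by linarith
  obtain ⟨q, hq⟩ : ∃ q, q = (1 + 4 * ε) / H := ⟨_, rfl⟩
  obtain ⟨p, hp⟩ : ∃ p, p = (1 - 4 * ε) / H := ⟨_, rfl⟩
  have hHq : H * q = 1 + 4 * ε := by rw [hq]; field_simp
  have hHp : H * p = 1 - 4 * ε := by rw [hp]; field_simp
  have q0 : 0 < q := by rw [hq]; positivity
  have p0 : 0 < p := by rw [hp]; apply div_pos <;> linarith
  have q1 : q ≤ 5 / 8 := by nlinarith
  have p1 : p ≤ 5 / 8 := by nlinarith
  obtain ⟨a, ha⟩ : ∃ a : (Fin m → Bool) → ℝ, a = fun b =>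
    P.real {ω | strat (fun i => gval H (b i)) ω < 1} := ⟨_, rfl⟩
  have uq := expRev_le q0.le (by linarith) hH P strat hs
  have up := expRev_le p0.le (by linarith) hH P strat hs
  have lq := (approx_ge q0.le (by linarith) hH (by linarith)
    (happ _ (twoPt_prob q0.le (by linarith)) (twoPt_supp hH))).2
  have lp := (approx_ge p0.le (by linarith) hH (by linarith)
    (happ _ (twoPt_prob p0.le (by linarith)) (twoPt_supp hH))).1
  have hchi := chi (p := p) q0 (by linarith) a (fun b => by rw [ha]; exact measureReal_nonneg)
    (fun b => by rw [ha]; exact measureReal_le_one)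
  rw [ha] at hchi
  simp only at hchi
  have cq := lq.trans uq
  have cp := lp.trans up
  clear uq up lq lp ha
  generalize (∑ b : Fin m → Bool, (∏ i, wt q (b i)) *
        P.real {ω | strat (fun i => gval H (b i)) ω < 1}) = x at *
  generalize (∑ b : Fin m → Bool, (∏ i, wt p (b i)) *
        P.real {ω | strat (fun i => gval H (b i)) ω < 1}) = y at *
  rw [hHq] at cq
  rw [hHp] at cp
  have hx : x ≤ 5 / 16 := by nlinarith
  have hy : 3 / 4 ≤ y := by nlinarith
  have hxy : 49 / 256 ≤ (y - x) ^ 2 := by nlinarith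
  have hc : (p - q) ^ 2 / (q * (1 - q)) ≤ 512 / 3 * ε ^ 2 / H := by
    have e1 : p - q = - 8 * ε / H := by rw [hp, hq]; field_simp; ring
    have e2 : 3 / 8 / H ≤ q * (1 - q) := by
      have : 1 / H ≤ q := by rw [hq]; gcongr; linarith
      have h3 : (0:ℝ) < 1 / H := by positivity
      calc 3 / 8 / H = 1 / H * (3 / 8) := by ring
        _ ≤ q * (1 - q) := by apply mul_le_mul this (by linarith) (by norm_num) q0.le
    calc (p - q) ^ 2 / (q * (1 - q)) ≤ (p - q) ^ 2 / (3 / 8 / H) := by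
          apply div_le_div_of_nonneg_left (sq_nonneg _) (by positivity) e2
      _ = 512 / 3 * ε ^ 2 / H := by rw [e1]; field_simp; norm_num
  have hc0 : 0 ≤ (p - q) ^ 2 / (q * (1 - q)) :=
    div_nonneg (sq_nonneg _) (mul_nonneg q0.le (by linarith))
  generalize (p - q) ^ 2 / (q * (1 - q)) = z at *
  have h1 : (1 + z) ^ m ≤ Real.exp (m * z) := by
    rw [Real.exp_nat_mul]
    exact pow_le_pow_left₀ (by linarith) (by linarith [Real.add_one_le_exp z]) m
  have h2 : 305 / 256 ≤ Real.exp (m * z) := by linarith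
  have h3 : 49 / 305 ≤ m * z := by
    have h4 := Real.add_one_le_exp (-(m * z))
    rw [Real.exp_neg] at h4
    have : (Real.exp (m * z))⁻¹ ≤ (305 / 256)⁻¹ := inv_anti₀ (by norm_num) h2
    norm_num at this
    linarith
  have h5 : 49 / 305 ≤ m * (512 / 3 * ε ^ 2 / H) :=
    h3.trans (mul_le_mul_of_nonneg_left hc (Nat.cast_nonneg m))
  have h6 : 49 / 305 * H ≤ m * (512 / 3 * ε ^ 2) := by
    rw [← mul_div_assoc, le_div_iff₀ hH0] at h5
    exact h5
  rw [inv_pow, ← div_eq_mul_inv, div_le_iff₀ (by positivity)]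
  linarith
end

section
/- For every MHR value distribution D with CDF F, the single-sample pricing strategy p(v) = 0.85·v satisfies E_{v∼D}[0.85·v·(1 − F(0.85·v))] ≥ 0.589 · max_r r·(1 − F(r)); that is, pricing at 0.85 times a single sample is 0.589-approximate for all MHR distributions. -/
open MeasureTheory Set

/-- A value distribution on `[0,∞)` with CDF `F`, density `f` (w.r.t. Lebesgue measure),
whose support is an interval contained in `[0,∞)`. -/
structure ValueDist where
  μ : Measure ℝ
  isProb : IsProbabilityMeasure μ
  f : ℝ → ℝ
  f_nonneg : ∀ x, 0 ≤ f x
  f_meas : Measurable f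
  density_eq : μ = volume.withDensity fun x => ENNReal.ofReal (f x)
  supp : Set ℝ
  supp_subset : supp ⊆ Ici 0
  supp_conn : supp.OrdConnected
  f_pos : ∀ x ∈ supp, 0 < f x
  f_zero : ∀ x ∉ supp, f x = 0

/-- The CDF of a value distribution. -/
noncomputable def ValueDist.F (D : ValueDist) (x : ℝ) : ℝ := (D.μ (Iic x)).toReal

/-- The virtual value function `φ(v) = v - (1 - F v) / f v`. -/
noncomputable def ValueDist.phi (D : ValueDist) (x : ℝ) : ℝ := x - (1 - D.F x) / D.f x

/-- Monotone hazard rate: the virtual value satisfies `dφ/dv ≥ 1` throughout the support. -/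
def ValueDist.IsMHR (D : ValueDist) : Prop :=
  ∀ x ∈ D.supp, ∃ d : ℝ, 1 ≤ d ∧ HasDerivWithinAt D.phi d D.supp x


lemma aux_exp_lower5 {x : ℝ} (hx : 0 ≤ x) :
    1 + x + x^2/2 + x^3/6 + x^4/24 + x^5/120 ≤ Real.exp x := by
  have := Real.sum_le_exp_of_nonneg hx 6
  simp [Finset.sum_range_succ, Nat.factorial] at this
  linarith

lemma aux_mono_of_deriv (f f' : ℝ → ℝ) (hf : ∀ x, HasDerivAt f (f' x) x)
    (h0 : f 0 = 0) (hp : ∀ x, 0 ≤ x → 0 ≤ f' x) {x : ℝ} (hx : 0 ≤ x) : 0 ≤ f x := by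
  have : MonotoneOn f (Ici 0) := by
    apply monotoneOn_of_deriv_nonneg (convex_Ici 0)
    · exact fun y _ => (hf y).continuousAt.continuousWithinAt
    · exact fun y _ => (hf y).differentiableAt.differentiableWithinAt
    · intro y hy
      rw [interior_Ici] at hy
      rw [(hf y).deriv]
      exact hp y (le_of_lt hy)
  have h := this (self_mem_Ici) hx hx
  linarith

lemma aux_hder (x : ℝ) : HasDerivAt (fun x => Real.exp (-x)) (-Real.exp (-x)) x := by
  simpa using (hasDerivAt_neg x).exp

lemma aux_en1 {x : ℝ} (hx : 0 ≤ x) : 0 ≤ Real.exp (-x) - (1 - x) := by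
  have := Real.add_one_le_exp (-x); linarith
lemma aux_en2 {x : ℝ} (hx : 0 ≤ x) : 0 ≤ (1 - x + x^2/2) - Real.exp (-x) := by
  refine aux_mono_of_deriv (fun x => (1 - x + x^2/2) - Real.exp (-x)) (fun x => Real.exp (-x) - (1 - x)) ?_ (by simp) (fun x hx => aux_en1 hx) hx
  intro x
  have := ((((hasDerivAt_const x (1:ℝ)).sub (hasDerivAt_id x)).add (((hasDerivAt_id x).pow 2).div_const 2))).sub (aux_hder x)
  refine this.congr_deriv ?_
  simp; ring
lemma aux_en3 {x : ℝ} (hx : 0 ≤ x) : 0 ≤ Real.exp (-x) - (1 - x + x^2/2 - x^3/6) := by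
  refine aux_mono_of_deriv (fun x => Real.exp (-x) - (1 - x + x^2/2 - x^3/6)) (fun x => (1 - x + x^2/2) - Real.exp (-x)) ?_ (by simp) (fun x hx => aux_en2 hx) hx
  intro x
  have := (aux_hder x).sub (((((hasDerivAt_const x (1:ℝ)).sub (hasDerivAt_id x)).add (((hasDerivAt_id x).pow 2).div_const 2))).sub (((hasDerivAt_id x).pow 3).div_const 6))
  refine this.congr_deriv ?_
  simp; ring
lemma aux_en4 {x : ℝ} (hx : 0 ≤ x) : 0 ≤ (1 - x + x^2/2 - x^3/6 + x^4/24) - Real.exp (-x) := by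
  refine aux_mono_of_deriv (fun x => (1 - x + x^2/2 - x^3/6 + x^4/24) - Real.exp (-x)) (fun x => Real.exp (-x) - (1 - x + x^2/2 - x^3/6)) ?_ (by simp) (fun x hx => aux_en3 hx) hx
  intro x
  have := ((((((hasDerivAt_const x (1:ℝ)).sub (hasDerivAt_id x)).add (((hasDerivAt_id x).pow 2).div_const 2))).sub (((hasDerivAt_id x).pow 3).div_const 6)).add (((hasDerivAt_id x).pow 4).div_const 24)).sub (aux_hder x)
  refine this.congr_deriv ?_
  simp; ring
lemma aux_en5 {x : ℝ} (hx : 0 ≤ x) : 0 ≤ Real.exp (-x) - (1 - x + x^2/2 - x^3/6 + x^4/24 - x^5/120) := by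
  refine aux_mono_of_deriv (fun x => Real.exp (-x) - (1 - x + x^2/2 - x^3/6 + x^4/24 - x^5/120)) (fun x => (1 - x + x^2/2 - x^3/6 + x^4/24) - Real.exp (-x)) ?_ (by simp) (fun x hx => aux_en4 hx) hx
  intro x
  have := (aux_hder x).sub (((((((hasDerivAt_const x (1:ℝ)).sub (hasDerivAt_id x)).add (((hasDerivAt_id x).pow 2).div_const 2))).sub (((hasDerivAt_id x).pow 3).div_const 6)).add (((hasDerivAt_id x).pow 4).div_const 24)).sub (((hasDerivAt_id x).pow 5).div_const 120))
  refine this.congr_deriv ?_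
  simp; ring

/-- The tail constant. -/
lemma aux_K : (0.66:ℝ) ≤ 0.85 * ((1 - Real.exp (-0.6)) + (1/1.85) * (1.66 * (Real.exp (-0.6*1.85) - Real.exp (-0.864*1.85)) + 1.8496 * (Real.exp (-0.864*1.85) - Real.exp (-1.35*1.85)) + 2.1025 * Real.exp (-1.35*1.85))) := by
  have h1 : Real.exp (-0.6) ≤ 0.5495 := by
    have := aux_en4 (x := 0.6) (by norm_num)
    norm_num at this ⊢; linarith
  have h2 : 0.3292 ≤ Real.exp (-0.6*1.85) := by
    have := aux_en5 (x := 0.555) (by norm_num)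
    have h : Real.exp (-0.6*1.85) = Real.exp (-0.555)^2 := by
      rw [← Real.exp_nat_mul]; norm_num
    rw [h]
    have h3 : 0.57403 ≤ Real.exp (-0.555) := by norm_num at this ⊢; linarith
    nlinarith
  have h3 : 0.201 ≤ Real.exp (-0.864*1.85) := by
    have := aux_en5 (x := 0.7992) (by norm_num)
    have h : Real.exp (-0.864*1.85) = Real.exp (-0.7992)^2 := by
      rw [← Real.exp_nat_mul]; norm_num
    rw [h]
    have h3 : 0.4490 ≤ Real.exp (-0.7992) := by norm_num at this ⊢; linarith
    nlinarith
  have h4 : 0.08 ≤ Real.exp (-1.35*1.85) := by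
    have := aux_en5 (x := 0.8325) (by norm_num)
    have h : Real.exp (-1.35*1.85) = Real.exp (-0.8325)^3 := by
      rw [← Real.exp_nat_mul]; norm_num
    rw [h]
    have h3 : 0.434 ≤ Real.exp (-0.8325) := by norm_num at this ⊢; linarith
    calc (0.08:ℝ) ≤ 0.434^3 := by norm_num
      _ ≤ _ := by gcongr
  linarith

lemma aux_final {h : ℝ} (hh : 0 < h) :
    0.589 ≤ 0.85 / h * ((Real.exp h - (1 + 1.85*h) * Real.exp (-(0.85*h))) / 1.85^2) + 0.66 * Real.exp (-h) := by
  have key : 0.589 * h * 1.85^2 ≤ 0.85 * (Real.exp h - (1 + 1.85*h) * Real.exp (-(0.85*h))) + 0.66 * 1.85^2 * h * Real.exp (-h) := by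
    have e1 := aux_exp_lower5 hh.le
    by_cases h2 : h ≤ 2
    · have e2 := aux_en4 (x := 0.85*h) (by positivity)
      have e3 := aux_en5 hh.le
      have e2' : (1 + 1.85*h) * Real.exp (-(0.85*h)) ≤ (1 + 1.85*h) * (1 - (0.85*h) + (0.85*h)^2/2 - (0.85*h)^3/6 + (0.85*h)^4/24) := by
        gcongr; linarith
      have e3' : h * (1 - h + h^2/2 - h^3/6 + h^4/24 - h^5/120) ≤ h * Real.exp (-h) := by
        gcongr; linarith
      have : 0.589 * h * 1.85^2 ≤ 0.85 * ((1 + h + h^2/2 + h^3/6 + h^4/24 + h^5/120) - (1 + 1.85*h) * (1 - (0.85*h) + (0.85*h)^2/2 - (0.85*h)^3/6 + (0.85*h)^4/24)) + 0.66 * 1.85^2 * (h * (1 - h + h^2/2 - h^3/6 + h^4/24 - h^5/120)) := by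
        have g : 0 ≤ (0.85 * ((1 + h/2 + h^2/6 + h^3/24 + h^4/120) - (1.85) * (1 - (0.85*h) + (0.85*h)^2/2 - (0.85*h)^3/6 + (0.85*h)^4/24) + 0.85 * (1 - 0.85*h/2 + (0.85*h)^2/6 - (0.85*h)^3/24)) + 0.66 * 1.85^2 * ( (1 - h + h^2/2 - h^3/6 + h^4/24 - h^5/120)) - 0.589 * 1.85^2) := by
          have h3 : 0 ≤ 2 - h := by linarith
          nlinarith [mul_nonneg hh.le (sq_nonneg (h-0.62)), sq_nonneg (h-0.62), mul_nonneg h3 (sq_nonneg (h-0.62)), mul_nonneg hh.le (sq_nonneg (h*(h-0.62))), mul_nonneg h3 (sq_nonneg (h*(h-0.62))), sq_nonneg (h*(h-0.62)), mul_nonneg hh.le h3]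
        nlinarith [mul_nonneg hh.le g]
      nlinarith
    · push Not at h2
      have e4 : (1 + 1.85*h) * Real.exp (-(0.85*h)) ≤ 2.18 := by
        have := Real.add_one_le_exp (0.85*h)
        rw [Real.exp_neg, ← div_eq_mul_inv, div_le_iff₀ (Real.exp_pos _)]
        nlinarith
      have e5 : 7.2 * (h - 1) ≤ Real.exp h := by
        nlinarith [pow_pos hh 3, pow_pos hh 4, pow_pos hh 5, mul_pos hh hh, sq_nonneg (h-2), mul_nonneg hh.le (sq_nonneg (h-2)), mul_nonneg (pow_pos hh 2).le (sq_nonneg (h-2)), mul_nonneg (pow_pos hh 3).le (sq_nonneg (h-2))]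
      have : 0 < h * Real.exp (-h) := by positivity
      nlinarith
  have : 0.85 / h * ((Real.exp h - (1 + 1.85*h) * Real.exp (-(0.85*h))) / 1.85^2) + 0.66 * Real.exp (-h) = (0.85 * (Real.exp h - (1 + 1.85*h) * Real.exp (-(0.85*h))) + 0.66 * 1.85^2 * h * Real.exp (-h)) / (h * 1.85^2) := by
    field_simp
  rw [this, le_div_iff₀ (by positivity)]
  linarith

/-- pointwise lower bound in terms of the quantile -/
noncomputable def auxPhi (r h u : ℝ) : ℝ :=
  if u ≤ Real.exp (-h) * Real.exp (-1.35) then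
    0.85 * r * Real.exp (-h) * 2.1025 * (u / Real.exp (-h)) ^ (0.85:ℝ)
  else if u ≤ Real.exp (-h) * Real.exp (-0.864) then
    0.85 * r * Real.exp (-h) * 1.8496 * (u / Real.exp (-h)) ^ (0.85:ℝ)
  else if u ≤ Real.exp (-h) * Real.exp (-0.6) then
    0.85 * r * Real.exp (-h) * 1.66 * (u / Real.exp (-h)) ^ (0.85:ℝ)
  else if u ≤ Real.exp (-h) then
    0.85 * r * Real.exp (-h)
  else 0.85 * r / h * (-Real.log u * u ^ (0.85:ℝ))

lemma aux_piece (C A : ℝ) {q x y : ℝ} (hq : 0 < q)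
    (f : ℝ → ℝ) (hxy : x ≤ y) (hf : ∀ u ∈ Ioc (q*x) (q*y), f u = C * A * (u / q) ^ (0.85:ℝ)) :
    IntervalIntegrable f volume (q*x) (q*y) ∧
    ∫ u in (q*x)..(q*y), f u = C * A * (q * ((y ^ (1.85:ℝ) - x ^ (1.85:ℝ)) / 1.85)) := by
  have hle : q*x ≤ q*y := by gcongr
  have hf' : EqOn f (fun u => C * A * (u / q) ^ (0.85:ℝ)) (uIoc (q*x) (q*y)) := by
    rw [uIoc_of_le hle]; exact hf
  have hc : Continuous (fun u : ℝ => C * A * (u / q) ^ (0.85:ℝ)) := by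
    refine continuous_const.mul ?_
    exact (continuous_id.div_const q).rpow_const (fun _ => Or.inr (by norm_num))
  constructor
  · exact (hc.intervalIntegrable _ _).congr hf'.symm
  · rw [intervalIntegral.integral_congr_ae (ae_of_all _ fun x hx => hf' hx), intervalIntegral.integral_const_mul,
      intervalIntegral.integral_comp_div (fun u => u ^ (0.85:ℝ)) hq.ne']
    rw [mul_div_cancel_left₀ _ hq.ne', mul_div_cancel_left₀ _ hq.ne', integral_rpow (Or.inl (by norm_num))]
    norm_num

lemma aux_piece_const (C : ℝ) {x y : ℝ} 
    (f : ℝ → ℝ) (hxy : x ≤ y) (hf : ∀ u ∈ Ioc (x) (y), f u = C) :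
    IntervalIntegrable f volume x y ∧
    ∫ u in x..y, f u = C * (y - x) := by
  have hf' : EqOn f (fun u => C) (uIoc x y) := by
    rw [uIoc_of_le hxy]; exact hf
  constructor
  · exact (continuous_const.intervalIntegrable _ _).congr hf'.symm
  · rw [intervalIntegral.integral_congr_ae (ae_of_all _ fun x hx => hf' hx)]
    simp [mul_comm]

lemma aux_piece_head (C : ℝ) {q : ℝ} (hq : 0 < q) (hq1 : q ≤ 1)
    (f : ℝ → ℝ) (hf : ∀ u ∈ Ioc q 1, f u = C * (-Real.log u * u ^ (0.85:ℝ))) :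
    IntervalIntegrable f volume q 1 ∧
    ∫ u in q..1, f u = C * ((1 - q ^ (1.85:ℝ)) / 1.85^2 + q ^ (1.85:ℝ) * Real.log q / 1.85) := by
  have hf' : EqOn f (fun u => C * (-Real.log u * u ^ (0.85:ℝ))) (uIoc q 1) := by
    rw [uIoc_of_le hq1]; exact hf
  have hc : ContinuousOn (fun u : ℝ => (-Real.log u * u ^ (0.85:ℝ))) (uIcc q 1) := by
    rw [uIcc_of_le hq1]
    refine ContinuousOn.mul (ContinuousOn.neg ?_) ?_
    · exact Real.continuousOn_log.mono (fun x hx => by simp; linarith [hx.1])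
    · exact (Real.continuous_rpow_const (by norm_num)).continuousOn
  constructor
  · exact (hc.intervalIntegrable.const_mul C).congr hf'.symm
  · rw [intervalIntegral.integral_congr_ae (ae_of_all _ fun x hx => hf' hx), intervalIntegral.integral_const_mul]
    congr 1
    rw [intervalIntegral.integral_eq_sub_of_hasDerivAt (f := fun u => u ^ (1.85:ℝ) / 1.85^2 - u ^ (1.85:ℝ) * Real.log u / 1.85) _ hc.intervalIntegrable]
    · simp; ring
    · intro x hx
      rw [uIcc_of_le hq1] at hx
      have hx0 : 0 < x := lt_of_lt_of_le hq hx.1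
      have d1 := Real.hasDerivAt_rpow_const (x := x) (p := 1.85) (Or.inl hx0.ne')
      have d2 := (d1.div_const (1.85^2)).sub ((d1.mul (Real.hasDerivAt_log hx0.ne')).div_const 1.85)
      refine d2.congr_deriv ?_
      have e : x ^ (1.85:ℝ) = x * x ^ (0.85:ℝ) := by
        rw [show (1.85:ℝ) = 1 + 0.85 by norm_num, Real.rpow_add hx0, Real.rpow_one]
      have e2 : (1.85:ℝ) - 1 = 0.85 := by norm_num
      rw [e, e2]
      field_simp
      ring

lemma aux_integral_Phi {r h : ℝ} (hr : 0 < r) (hh : 0 ≤ h) :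
    0.589 * (r * Real.exp (-h)) ≤ ∫ u in (0:ℝ)..1, auxPhi r h u := by
  set q := Real.exp (-h) with hq
  have hq0 : 0 < q := Real.exp_pos _
  have hq1 : q ≤ 1 := by rw [hq, Real.exp_le_one_iff]; linarith
  have l1 : Real.exp (-1.35) ≤ Real.exp (-0.864) := by gcongr; norm_num
  have l2 : Real.exp (-0.864) ≤ Real.exp (-0.6) := by gcongr; norm_num
  have l3 : Real.exp (-0.6) ≤ 1 := by rw [Real.exp_le_one_iff]; norm_num
  have l0 := (Real.exp_pos (-1.35)).le
  have m1 : q * Real.exp (-1.35) ≤ q * Real.exp (-0.864) := by gcongr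
  have m2 : q * Real.exp (-0.864) ≤ q * Real.exp (-0.6) := by gcongr
  have m3 : q * Real.exp (-0.6) ≤ q := by nlinarith
  obtain ⟨i1, j1⟩ := aux_piece (0.85 * r * q) 2.1025 hq0 (auxPhi r h) l0 (by
    intro u hu; unfold auxPhi; rw [if_pos hu.2])
  obtain ⟨i2, j2⟩ := aux_piece (0.85 * r * q) 1.8496 hq0 (auxPhi r h) l1 (by
    intro u hu; unfold auxPhi; rw [if_neg (not_le.2 hu.1), if_pos hu.2])
  obtain ⟨i3, j3⟩ := aux_piece (0.85 * r * q) 1.66 hq0 (auxPhi r h) l2 (by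
    intro u hu; unfold auxPhi
    rw [if_neg (not_le.2 (m1.trans_lt hu.1)), if_neg (not_le.2 hu.1), if_pos hu.2])
  obtain ⟨i4, j4⟩ := aux_piece_const (0.85 * r * q) (auxPhi r h) m3 (by
    intro u hu; unfold auxPhi
    rw [if_neg (not_le.2 ((m1.trans m2).trans_lt hu.1)), if_neg (not_le.2 (m2.trans_lt hu.1)), if_neg (not_le.2 hu.1), if_pos hu.2])
  obtain ⟨i5, j5⟩ := aux_piece_head (0.85 * r / h) hq0 hq1 (auxPhi r h) (by
    intro u hu; unfold auxPhi
    rw [if_neg (not_le.2 (((m1.trans m2).trans m3).trans_lt hu.1)), if_neg (not_le.2 ((m2.trans m3).trans_lt hu.1)), if_neg (not_le.2 (m3.trans_lt hu.1)), if_neg (not_le.2 hu.1)])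
  rw [mul_zero] at i1 j1
  rw [← intervalIntegral.integral_add_adjacent_intervals (((i1.trans i2).trans i3).trans i4) i5,
    ← intervalIntegral.integral_add_adjacent_intervals ((i1.trans i2).trans i3) i4,
    ← intervalIntegral.integral_add_adjacent_intervals (i1.trans i2) i3,
    ← intervalIntegral.integral_add_adjacent_intervals i1 i2, j1, j2, j3, j4, j5]
  rw [Real.zero_rpow (by norm_num), ← Real.exp_mul, ← Real.exp_mul, ← Real.exp_mul, hq, ← Real.exp_mul, Real.log_exp, ← hq]
  have K := aux_K
  have hK : 0.66 * (r * q * q) ≤ 0.85 * ((1 - Real.exp (-0.6)) + (1/1.85) * (1.66 * (Real.exp (-0.6*1.85) - Real.exp (-0.864*1.85)) + 1.8496 * (Real.exp (-0.864*1.85) - Real.exp (-1.35*1.85)) + 2.1025 * Real.exp (-1.35*1.85))) * (r * q * q) := by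
    gcongr
  clear i1 i2 i3 i4 i5 j1 j2 j3 j4 j5 K l1 l2 l3 l0 m1 m2 m3
  generalize Real.exp (-0.6*1.85) = E1 at hK ⊢
  generalize Real.exp (-0.864*1.85) = E2 at hK ⊢
  generalize Real.exp (-1.35*1.85) = E3 at hK ⊢
  generalize Real.exp (-0.6) = E0 at hK ⊢
  have hring : 0.85 * r * q * 2.1025 * (q * ((E3 - 0) / 1.85)) + 0.85 * r * q * 1.8496 * (q * ((E2 - E3) / 1.85)) +
          0.85 * r * q * 1.66 * (q * ((E1 - E2) / 1.85)) + 0.85 * r * q * (q - q * E0) = 0.85 * (1 - E0 + 1 / 1.85 * (1.66 * (E1 - E2) + 1.8496 * (E2 - E3) + 2.1025 * E3)) * (r * q * q) := by ring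
  rw [hring]
  generalize 0.85 * (1 - E0 + 1 / 1.85 * (1.66 * (E1 - E2) + 1.8496 * (E2 - E3) + 2.1025 * E3)) * (r * q * q) = Y at hK ⊢
  rcases hh.eq_or_lt with h0 | h0
  · subst h0
    have : q = 1 := by simp [hq]
    rw [this] at hK ⊢
    simp only [div_zero, zero_mul]
    linarith
  · have fin := mul_le_mul_of_nonneg_right (aux_final h0) (by positivity : 0 ≤ r * q)
    have e1 : Real.exp h * q = 1 := by rw [hq, ← Real.exp_add]; simp
    have e2 : Real.exp (-(0.85*h)) * q = Real.exp (-h * 1.85) := by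
      rw [hq, ← Real.exp_add]; congr 1; ring
    have e3 : 0.85 / h * ((Real.exp h - (1 + 1.85*h) * Real.exp (-(0.85*h))) / 1.85^2) * (r * q) =
       0.85 * r / h * ((1 - Real.exp (-h * 1.85)) / 1.85 ^ 2 + Real.exp (-h * 1.85) * -h / 1.85) := by
      rw [← e2]
      have : 0.85 / h * ((Real.exp h - (1 + 1.85*h) * Real.exp (-(0.85*h))) / 1.85^2) * (r * q) = 0.85 * r / h * ((Real.exp h * q - (1 + 1.85*h) * (Real.exp (-(0.85*h)) * q)) / 1.85^2) := by ring
      rw [this, e1]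
      ring
    rw [add_mul, e3, ← hq] at fin
    generalize 0.85 * r / h * ((1 - Real.exp (-h * 1.85)) / 1.85 ^ 2 + Real.exp (-h * 1.85) * -h / 1.85) = X at fin ⊢
    linarith

lemma aux_N1 {s z l : ℝ} (hs : s ≤ 0.6) (hz : 0 < z) (hl0 : 0 ≤ l)
    (hl : l * z = 0.85 * z - 0.15) : 1 ≤ (1 + z) * Real.exp (-(l * s)) := by
  have h1 := Real.add_one_le_exp (-(l*s))
  have h2 : (1 + z) * (1 - l * s) ≤ (1 + z) * Real.exp (-(l * s)) := by
    gcongr; linarith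
  have h3 : (1 + z) * l * s ≤ (1 + z) * l * 0.6 := by gcongr
  have h4 : (1 + z) * l * 0.6 ≤ z := by
    have : (1 + z) * l * 0.6 * z ≤ z * z := by
      have : (1 + z) * l * 0.6 * z = (1 + z) * 0.6 * (l * z) := by ring
      rw [this, hl]
      nlinarith [sq_nonneg (0.7 * z - 0.3)]
    exact le_of_mul_le_mul_right this hz
  nlinarith

lemma aux_N2 {s z l : ℝ} (σ : ℝ) (hσ : 0 ≤ σ) (hs : σ^2 ≤ 0.15 * s) (hz : 0 < z)
    (hl : l * z = 0.85 * z - 0.15) :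
    (1 + σ)^2 * Real.exp (-(0.85 * s)) ≤ (1 + z) * Real.exp (-(l * s)) := by
  have e : -(l * s) = -(0.85 * s) + 0.15 * s / z := by
    field_simp
    linear_combination (-s) * hl
  rw [e, Real.exp_add]
  have h1 := Real.add_one_le_exp (0.15 * s / z)
  have h2 : σ^2 / z ≤ 0.15 * s / z := by gcongr
  have h3 : (1 + σ)^2 ≤ (1 + z) * (1 + σ^2/z) := by
    have : (1 + z) * (1 + σ^2/z) - (1 + σ)^2 = (z - σ)^2 / z := by
      field_simp; ring
    have : 0 ≤ (z - σ)^2 / z := by positivity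
    linarith
  have h4 : (1 + σ)^2 ≤ (1 + z) * Real.exp (0.15 * s / z) := by
    refine h3.trans ?_
    gcongr; linarith
  calc _ ≤ (1 + z) * Real.exp (0.15 * s / z) * Real.exp (-(0.85*s)) := by gcongr
    _ = _ := by ring

lemma aux_N3 {s k s0 : ℝ} (hs0 : 0 ≤ s0) (hs : s0 ≤ s) (hk : k ≤ 1 + (0.85*s0) + (0.85*s0)^2/2 + (0.85*s0)^3/6 + (0.85*s0)^4/24 + (0.85*s0)^5/120) :
    k * Real.exp (-(0.85 * s)) ≤ 1 := by
  have h1 := aux_exp_lower5 (x := 0.85 * s0) (by positivity)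
  have h2 : Real.exp (0.85*s0) ≤ Real.exp (0.85*s) := by gcongr
  rw [Real.exp_neg, ← div_eq_mul_inv, div_le_one (Real.exp_pos _)]
  linarith

lemma aux_chord {S : ℝ → ℝ} (hconc : ConcaveOn ℝ {x | 0 < S x} (fun x => Real.log (S x)))
    {p x m l : ℝ} (hp : 0 < S p) (hx : 0 < S x) (h0 : 0 ≤ l) (h1 : l ≤ 1)
    (hm : m = (1 - l) * p + l * x) :
    0 < S m ∧ (1 - l) * Real.log (S p) + l * Real.log (S x) ≤ Real.log (S m) := by
  have h3 : (0:ℝ) ≤ 1 - l := by linarith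
  have h4 : (1 - l) + l = 1 := by ring
  have := hconc.2 (x := p) hp (y := x) hx h3 h0 h4
  have h5 := hconc.1 (x := p) hp (y := x) hx h3 h0 h4
  simp only [smul_eq_mul, mem_ofPred_eq, ← hm] at this h5
  exact ⟨h5, this⟩

lemma aux_pointwise {S : ℝ → ℝ} (hanti : Antitone S) (hS0 : S 0 = 1) 
    (hconc : ConcaveOn ℝ {x | 0 < S x} (fun x => Real.log (S x)))
    {r h x : ℝ} (hr : 0 < r) (hSr : S r = Real.exp (-h)) (hx : 0 ≤ x)
    (hSx : 0 < S x) (hne : S x ≠ S r) :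
    auxPhi r h (S x) ≤ 0.85 * x * S (0.85 * x) := by
  have hSr0 : 0 < S r := by rw [hSr]; positivity
  have hlr : Real.log (S r) = -h := by rw [hSr, Real.log_exp]
  have hS00 : 0 < S 0 := by rw [hS0]; norm_num
  have hl0 : Real.log (S 0) = 0 := by rw [hS0, Real.log_one]
  rcases lt_or_gt_of_ne hne with hlt | hgt
  · have hrx : r < x := by
      by_contra hcon
      push Not at hcon
      exact absurd (hanti hcon) (not_le.2 hlt)
    obtain ⟨s, hs⟩ : ∃ s, s = -(Real.log (S x) + h) := ⟨_, rfl⟩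
    have hu : S x = Real.exp (-h) * Real.exp (-s) := by
      rw [← Real.exp_add, hs, neg_neg, neg_add_cancel_comm_assoc, Real.exp_log hSx]
    have hs0 : 0 < s := by
      have := Real.log_lt_log hSx hlt
      linarith
    set z := x / r - 1 with hz
    have hxz : x = r * (1 + z) := by rw [hz]; field_simp; ring
    have hz0 : 0 < z := by rw [hz, sub_pos, one_lt_div hr]; exact hrx
    -- general bound
    have main : 0.85 * r * Real.exp (-h) ≤ 0.85 * x * S (0.85 * x) ∨
        ∃ l, 0 ≤ l ∧ l * z = 0.85 * z - 0.15 ∧ 0.85 * r * Real.exp (-h) * ((1 + z) * Real.exp (-(l * s))) ≤ 0.85 * x * S (0.85 * x) := by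
      rcases le_total (0.85 * x) r with hc | hc
      · left
        have := hanti hc
        rw [hSr] at this
        have := Real.exp_pos (-h)
        gcongr
      · right
        have hl : ((0.85 * z - 0.15) / z) * z = 0.85 * z - 0.15 := by field_simp
        have hn : 0 ≤ 0.85 * z - 0.15 := by
          have : r * 0 ≤ r * (0.85 * z - 0.15) := by rw [hxz] at hc; linarith
          exact le_of_mul_le_mul_left this hr
        have hlp : 0 ≤ (0.85 * z - 0.15) / z := by positivity
        refine ⟨(0.85 * z - 0.15) / z, hlp, hl, ?_⟩
        obtain ⟨c1, c2⟩ := aux_chord (m := 0.85 * x) hconc hSr0 hSx hlp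
          (by rw [div_le_one hz0]; linarith) (by
            rw [hxz]; linear_combination (-r) * hl)
        rw [hlr] at c2
        have c3 : -h + -((0.85 * z - 0.15) / z * s) ≤ Real.log (S (0.85 * x)) := by
          refine le_trans (le_of_eq ?_) c2
          rw [hs]; ring
        have c4 := (Real.le_log_iff_exp_le c1).1 c3
        rw [Real.exp_add] at c4
        calc _ = 0.85 * x * (Real.exp (-h) * Real.exp (-((0.85 * z - 0.15) / z * s))) := by
              rw [hxz]; ring
          _ ≤ _ := by gcongr
    have hpow : (S x / Real.exp (-h)) ^ (0.85:ℝ) = Real.exp (-(0.85 * s)) := by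
      rw [hu, mul_div_cancel_left₀ _ (Real.exp_pos _).ne', ← Real.exp_mul]
      congr 1; ring
    have hC : 0 ≤ 0.85 * r * Real.exp (-h) := by positivity
    have cmp : ∀ t : ℝ, S x ≤ Real.exp (-h) * Real.exp (-t) ↔ t ≤ s := by
      intro t
      rw [hu, mul_le_mul_iff_right₀ (Real.exp_pos _), Real.exp_le_exp, neg_le_neg_iff]
    have piece : ∀ σ k s0 : ℝ, 0 ≤ σ → 0 ≤ s0 → σ^2 = 0.15 * s0 → s0 ≤ s → k ≤ (1 + σ)^2 →
        k ≤ 1 + (0.85*s0) + (0.85*s0)^2/2 + (0.85*s0)^3/6 + (0.85*s0)^4/24 + (0.85*s0)^5/120 →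
        0.85 * r * Real.exp (-h) * k * Real.exp (-(0.85 * s)) ≤ 0.85 * x * S (0.85 * x) := by
      intro σ k s0 hσ hs0' hσs hss hk1 hk2
      rcases main with hm | ⟨l, h1, h2, h3⟩
      · refine le_trans ?_ hm
        rw [mul_assoc]
        exact mul_le_of_le_one_right hC (aux_N3 hs0' hss hk2)
      · refine le_trans ?_ h3
        rw [mul_assoc]
        refine mul_le_mul_of_nonneg_left ?_ hC
        refine le_trans ?_ (aux_N2 σ hσ (by rw [hσs]; linarith) hz0 h2)
        gcongr
    unfold auxPhi
    rw [hpow]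
    split_ifs with i1 i2 i3 i4
    · rw [cmp] at i1
      exact piece 0.45 _ 1.35 (by norm_num) (by norm_num) (by norm_num) i1 (by norm_num) (by norm_num)
    · rw [cmp] at i2
      exact piece 0.36 _ 0.864 (by norm_num) (by norm_num) (by norm_num) i2 (by norm_num) (by norm_num)
    · rw [cmp] at i3
      exact piece 0.3 _ 0.6 (by norm_num) (by norm_num) (by norm_num) i3 (by norm_num) (by norm_num)
    · rw [cmp] at i3
      push Not at i3
      rcases main with hm | ⟨l, h1, h2, h3⟩
      · exact hm
      · refine le_trans ?_ h3
        exact le_mul_of_one_le_right hC (aux_N1 i3.le hz0 h1 h2)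
    · exact absurd (hSr ▸ hlt.le) i4
  · have hxr : x < r := by
      by_contra hcon
      push Not at hcon
      exact absurd (hanti hcon) (not_le.2 hgt)
    have hSx1 : S x ≤ 1 := hS0 ▸ hanti hx
    have hh : 0 < h := by
      have h1 := Real.log_lt_log hSr0 hgt
      have h2 := Real.log_nonpos hSx.le hSx1
      linarith
    have q1 : Real.exp (-h) < S x := hSr ▸ hgt
    have mm : ∀ t : ℝ, 0 ≤ t → ¬ (S x ≤ Real.exp (-h) * Real.exp (-t)) := by
      intro t ht
      push Not
      refine lt_of_le_of_lt ?_ q1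
      exact mul_le_of_le_one_right (Real.exp_pos _).le (by rw [Real.exp_le_one_iff]; linarith)
    unfold auxPhi
    rw [if_neg (mm _ (by norm_num)), if_neg (mm _ (by norm_num)), if_neg (mm _ (by norm_num)), if_neg (not_le.2 q1)]
    obtain ⟨_, c2⟩ := aux_chord (m := x) (l := x / r) hconc hS00 hSr0 (by positivity)
      (by rw [div_le_one hr]; exact hxr.le) (by field_simp; ring)
    rw [hl0, hlr] at c2
    obtain ⟨d1, d2⟩ := aux_chord (m := 0.85 * x) (l := 0.85) hconc hS00 hSx (by norm_num)
      (by norm_num) (by ring)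
    rw [hl0] at d2
    have d3 : S x ^ (0.85:ℝ) ≤ S (0.85 * x) := by
      rw [Real.rpow_def_of_pos hSx, ← Real.le_log_iff_exp_le d1]
      linarith
    have c3 : r / h * (-Real.log (S x)) ≤ x := by
      have : -Real.log (S x) ≤ x / r * h := by linarith
      calc _ ≤ r / h * (x / r * h) := by gcongr
        _ = x := by field_simp
    have hp : 0 ≤ S x ^ (0.85:ℝ) := by positivity
    calc _ = 0.85 * (r / h * (-Real.log (S x))) * S x ^ (0.85:ℝ) := by ring
      _ ≤ 0.85 * x * S x ^ (0.85:ℝ) := by gcongr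
      _ ≤ _ := by gcongr

lemma aux_F_eq (D : ValueDist) : D.F = fun x => ProbabilityTheory.cdf D.μ x := by
  have := D.isProb
  funext x
  rw [ProbabilityTheory.cdf_eq_real]; rfl

lemma aux_f_int (D : ValueDist) : Integrable D.f volume := by
  have := D.isProb
  refine ⟨D.f_meas.aestronglyMeasurable, ?_⟩
  rw [hasFiniteIntegral_iff_ofReal (ae_of_all _ D.f_nonneg)]
  have h1 : D.μ univ = 1 := measure_univ
  rw [D.density_eq, withDensity_apply _ MeasurableSet.univ, setLIntegral_univ] at h1
  rw [h1]; exact ENNReal.one_lt_top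

lemma aux_F_integral (D : ValueDist) (x : ℝ) : D.F x = ∫ t in Iic x, D.f t := by
  unfold ValueDist.F
  rw [D.density_eq, withDensity_apply _ measurableSet_Iic,
    integral_eq_lintegral_of_nonneg_ae (ae_of_all _ D.f_nonneg) D.f_meas.aestronglyMeasurable]

lemma aux_F_sub (D : ValueDist) (x y : ℝ) : D.F y = D.F x + ∫ t in x..y, D.f t := by
  rw [aux_F_integral, aux_F_integral, ← intervalIntegral.integral_Iic_sub_Iic (aux_f_int D).integrableOn (aux_f_int D).integrableOn]
  ring

lemma aux_F_cont (D : ValueDist) : Continuous D.F := by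
  have : D.F = fun y => D.F 0 + ∫ t in (0:ℝ)..y, D.f t := by
    funext y; exact aux_F_sub D 0 y
  rw [this]
  exact continuous_const.add ((aux_f_int D).continuous_primitive 0)

lemma aux_F_mono (D : ValueDist) : Monotone D.F := by
  rw [aux_F_eq]; exact ProbabilityTheory.monotone_cdf _

lemma aux_F_le_one (D : ValueDist) (x : ℝ) : D.F x ≤ 1 := by
  rw [aux_F_eq]; exact ProbabilityTheory.cdf_le_one _ _

lemma aux_F_nonneg (D : ValueDist) (x : ℝ) : 0 ≤ D.F x := ENNReal.toReal_nonneg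

lemma aux_F_top (D : ValueDist) : Filter.Tendsto D.F Filter.atTop (nhds 1) := by
  rw [aux_F_eq]; have := D.isProb; exact ProbabilityTheory.tendsto_cdf_atTop _

lemma aux_F_zero (D : ValueDist) {x : ℝ} (hx : ∀ y ∈ D.supp, x ≤ y) : D.F x = 0 := by
  rw [aux_F_integral, integral_Iic_eq_integral_Iio]
  apply setIntegral_eq_zero_of_forall_eq_zero
  intro t ht
  exact D.f_zero t (fun h => absurd (hx t h) (not_le.2 ht))

lemma aux_F_one (D : ValueDist) {x : ℝ} (hx : ∀ y ∈ D.supp, y ≤ x) : D.F x = 1 := by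
  have hc : ∀ y, x ≤ y → D.F y = D.F x := by
    intro y hy
    rw [aux_F_sub D x y, intervalIntegral.integral_of_le hy]
    rw [setIntegral_eq_zero_of_forall_eq_zero, add_zero]
    intro t ht
    exact D.f_zero t (fun h => absurd (hx t h) (not_le.2 ht.1))
  have h2 : Filter.Tendsto D.F Filter.atTop (nhds (D.F x)) := by
    refine tendsto_const_nhds.congr' ?_
    filter_upwards [Filter.eventually_ge_atTop x] with y hy
    exact (hc y hy).symm
  exact tendsto_nhds_unique h2 (aux_F_top D)

lemma aux_ae_nonneg (D : ValueDist) : ∀ᵐ x ∂D.μ, 0 ≤ x := by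
  have := D.isProb
  have h0 : D.F 0 = 0 := aux_F_zero D (fun y hy => D.supp_subset hy)
  have : D.μ (Iic 0) = 0 := by
    unfold ValueDist.F at h0
    rcases (ENNReal.toReal_eq_zero_iff _).1 h0 with h | h
    · exact h
    · exact absurd h (measure_ne_top _ _)
  rw [ae_iff]
  refine measure_mono_null ?_ this
  intro x hx
  have : ¬ 0 ≤ x := hx
  exact (not_le.1 this).le

lemma aux_map (D : ValueDist) : Measure.map D.F D.μ = volume.restrict (Icc 0 1) := by
  have := D.isProb
  have hm : Measurable D.F := (aux_F_cont D).measurable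
  have : IsProbabilityMeasure (Measure.map D.F D.μ) := Measure.isProbabilityMeasure_map hm.aemeasurable
  apply Measure.ext_of_Iic
  intro t
  rw [Measure.map_apply hm measurableSet_Iic, Measure.restrict_apply measurableSet_Iic]
  have h00 : D.F 0 = 0 := aux_F_zero D (fun y hy => D.supp_subset hy)
  rcases lt_or_ge t 0 with ht | ht
  · have e1 : D.F ⁻¹' Iic t = ∅ := by
      ext x; simp; linarith [aux_F_nonneg D x]
    have e2 : Iic t ∩ Icc (0:ℝ) 1 = ∅ := by
      ext x; simp; intro h1 h2; linarith
    rw [e1, e2]; simp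
  rcases le_or_gt 1 t with ht1 | ht1
  · have e1 : D.F ⁻¹' Iic t = univ := by
      ext x; simp; linarith [aux_F_le_one D x]
    have e2 : Iic t ∩ Icc (0:ℝ) 1 = Icc 0 1 := by
      ext x; simp; intro h1 h2; linarith
    rw [e1, e2]; simp
  have e2 : Iic t ∩ Icc (0:ℝ) 1 = Icc 0 t := by
    ext x; simp; constructor
    · rintro ⟨h1, h2, h3⟩; exact ⟨h2, h1⟩
    · rintro ⟨h1, h2⟩; exact ⟨h2, h1, by linarith⟩
  set A := D.F ⁻¹' Iic t with hA
  have hne : A.Nonempty := ⟨0, by simp [hA, h00, ht]⟩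
  have hbdd : BddAbove A := by
    obtain ⟨M, hM⟩ := ((aux_F_top D).eventually (lt_mem_nhds ht1)).exists
    refine ⟨M, fun x hx => ?_⟩
    by_contra hcon
    push Not at hcon
    have h1 := aux_F_mono D hcon.le
    have h2 : D.F x ≤ t := hx
    linarith
  have hcl : IsClosed A := isClosed_Iic.preimage (aux_F_cont D)
  have hmem : sSup A ∈ A := hcl.csSup_mem hne hbdd
  have hAe : A = Iic (sSup A) := by
    ext x
    constructor
    · exact fun hx => le_csSup hbdd hx
    · intro hx
      exact (aux_F_mono D hx).trans hmem
  have hFs : D.F (sSup A) = t := by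
    apply le_antisymm hmem
    have h3 : Filter.Tendsto D.F (nhdsWithin (sSup A) (Ioi (sSup A))) (nhds (D.F (sSup A))) :=
      (aux_F_cont D).continuousAt.continuousWithinAt
    refine ge_of_tendsto h3 ?_
    filter_upwards [self_mem_nhdsWithin] with y hy
    by_contra hcon
    push Not at hcon
    have : y ∈ A := hcon.le
    exact absurd (le_csSup hbdd this) (not_le.2 hy)
  rw [e2, Real.volume_Icc, hAe, ← ENNReal.ofReal_toReal (measure_ne_top D.μ (Iic (sSup A)))]
  congr 1
  rw [sub_zero]; exact hFs

lemma aux_integral_comp (D : ValueDist) (g : ℝ → ℝ) (hg : Measurable g) :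
    ∫ x, g (1 - D.F x) ∂D.μ = ∫ u in (0:ℝ)..1, g u := by
  have hm : Measurable D.F := (aux_F_cont D).measurable
  have h1 : ∫ x, g (1 - D.F x) ∂D.μ = ∫ y, g (1 - y) ∂(Measure.map D.F D.μ) := by
    rw [integral_map hm.aemeasurable]
    exact (hg.comp (measurable_const.sub measurable_id)).aestronglyMeasurable
  rw [h1, aux_map, integral_Icc_eq_integral_Ioc, ← intervalIntegral.integral_of_le zero_le_one,
    intervalIntegral.integral_comp_sub_left (fun u => g u)]
  simp

lemma aux_ae_ne (D : ValueDist) (c : ℝ) : ∀ᵐ x ∂D.μ, 1 - D.F x ≠ c := by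
  have hm : Measurable D.F := (aux_F_cont D).measurable
  have : ∀ᵐ y ∂(Measure.map D.F D.μ), y ≠ 1 - c := by
    rw [aux_map]; exact Measure.ae_ne _ _
  have := ae_of_ae_map hm.aemeasurable this
  filter_upwards [this] with x hx h
  apply hx; linarith

lemma aux_conc (D : ValueDist) (hMHR : D.IsMHR) :
    ConcaveOn ℝ {x | 0 < 1 - D.F x} (fun x => Real.log (1 - D.F x)) := by
  have hne : D.supp.Nonempty := by
    by_contra hcon
    rw [not_nonempty_iff_eq_empty] at hcon
    have h1 := aux_F_zero D (x := 0) (by simp [hcon])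
    have h2 := aux_F_one D (x := 0) (by simp [hcon])
    linarith
  have hbb : BddBelow D.supp := ⟨0, fun y hy => D.supp_subset hy⟩
  set a := sInf D.supp with ha
  have hFa : ∀ x ≤ a, D.F x = 0 := fun x hx => aux_F_zero D (fun y hy => hx.trans (csInf_le hbb hy))
  set U := {x | a < x ∧ 0 < 1 - D.F x} with hU
  have hUo : IsOpen U := by
    apply IsOpen.inter isOpen_Ioi
    exact isOpen_lt continuous_const (continuous_const.sub (aux_F_cont D))
  have hUs : U ⊆ D.supp := by
    rintro x ⟨hx1, hx2⟩
    obtain ⟨y, hy, hyx⟩ := exists_lt_of_csInf_lt hne hx1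
    have : ∃ z ∈ D.supp, x < z := by
      by_contra hcon
      push Not at hcon
      linarith [aux_F_one D hcon]
    obtain ⟨z, hz, hxz⟩ := this
    exact D.supp_conn.out hy hz ⟨hyx.le, hxz.le⟩
  have hPc : ∀ c, Convex ℝ ({x | c ≤ x} ∩ {x | 0 < 1 - D.F x}) := by
    intro c
    apply OrdConnected.convex
    constructor
    rintro x ⟨hx1, hx2⟩ y ⟨hy1, hy2⟩ z ⟨hz1, hz2⟩
    refine ⟨le_trans hx1 hz1, ?_⟩
    have := aux_F_mono D hz2
    have : 0 < 1 - D.F y := hy2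
    show 0 < 1 - D.F z
    linarith
  have hUc : Convex ℝ U := by
    apply OrdConnected.convex
    constructor
    rintro x ⟨hx1, hx2⟩ y ⟨hy1, hy2⟩ z ⟨hz1, hz2⟩
    refine ⟨lt_of_lt_of_le hx1 hz1, ?_⟩
    have := aux_F_mono D hz2
    linarith
  -- the inverse hazard rate
  have hphi : ∀ x ∈ U, ∃ d, 1 ≤ d ∧ HasDerivAt D.phi d x := by
    intro x hx
    obtain ⟨d, hd, hd2⟩ := hMHR x (hUs hx)
    exact ⟨d, hd, hd2.hasDerivAt (Filter.mem_of_superset (hUo.mem_nhds hx) hUs)⟩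
  have hG : AntitoneOn (fun x => x - D.phi x) U := by
    apply antitoneOn_of_deriv_nonpos hUc
    · intro x hx
      obtain ⟨d, hd, hd2⟩ := hphi x hx
      exact ((hasDerivAt_id x).sub hd2).continuousAt.continuousWithinAt
    · intro x hx
      obtain ⟨d, hd, hd2⟩ := hphi x (interior_subset hx)
      exact ((hasDerivAt_id x).sub hd2).differentiableAt.differentiableWithinAt
    · intro x hx
      obtain ⟨d, hd, hd2⟩ := hphi x (interior_subset hx)
      have : HasDerivAt (fun x => x - D.phi x) (1 - d) x := (hasDerivAt_id x).sub hd2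
      rw [this.deriv]; linarith
  have hGe : ∀ x, x - D.phi x = (1 - D.F x) / D.f x := by
    intro x; unfold ValueDist.phi; ring
  have hGp : ∀ x ∈ U, 0 < x - D.phi x := by
    intro x hx
    rw [hGe]
    exact div_pos hx.2 (D.f_pos x (hUs hx))
  have hfc : ∀ x ∈ U, ContinuousAt D.f x := by
    intro x hx
    obtain ⟨d, hd, hd2⟩ := hphi x hx
    have c1 : ContinuousAt (fun x => (1 - D.F x) / (x - D.phi x)) x :=
      (continuous_const.sub (aux_F_cont D)).continuousAt.div
        (continuousAt_id.sub hd2.continuousAt) (hGp x hx).ne'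
    refine c1.congr ?_
    filter_upwards [hUo.mem_nhds hx] with y hy
    rw [hGe]
    have h1 := D.f_pos y (hUs hy)
    have h2 := hy.2
    field_simp
  have hFd : ∀ x ∈ U, HasDerivAt D.F (D.f x) x := by
    intro x hx
    have h1 : D.F = fun y => D.F a + ∫ t in a..y, D.f t := by
      funext y; exact aux_F_sub D a y
    rw [h1]
    have := intervalIntegral.integral_hasDerivAt_right (a := a) (b := x) (f := D.f)
      (aux_f_int D).intervalIntegrable
      (D.f_meas.stronglyMeasurable.stronglyMeasurableAtFilter) (hfc x hx)
    simpa using this.const_add (D.F a)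
  have hLd : ∀ x ∈ U, HasDerivAt (fun x => Real.log (1 - D.F x)) (-(x - D.phi x)⁻¹) x := by
    intro x hx
    have := ((hFd x hx).const_sub 1).log hx.2.ne'
    refine this.congr_deriv ?_
    rw [hGe, inv_div, neg_div]
  set V := {x | a ≤ x} ∩ {x | 0 < 1 - D.F x} with hV
  have hVi : interior V ⊆ U := by
    intro x hx
    have h1 : interior V ⊆ interior (Ici a) := interior_mono (fun y hy => hy.1)
    rw [interior_Ici] at h1
    exact ⟨h1 hx, (interior_subset hx).2⟩
  have hLc : ConcaveOn ℝ V (fun x => Real.log (1 - D.F x)) := by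
    apply AntitoneOn.concaveOn_of_deriv (hPc a)
    · apply ContinuousOn.log
      · exact (continuous_const.sub (aux_F_cont D)).continuousOn
      · intro x hx; exact (ne_of_gt hx.2)
    · intro x hx
      exact (hLd x (hVi hx)).differentiableAt.differentiableWithinAt
    · intro x hx y hy hxy
      rw [(hLd x (hVi hx)).deriv, (hLd y (hVi hy)).deriv]
      have := hG (hVi hx) (hVi hy) hxy
      have h2 := hGp y (hVi hy)
      simp only at this
      have := inv_anti₀ h2 this
      linarith
  have hLa : AntitoneOn (fun x => Real.log (1 - D.F x)) V := by
    intro x hx y hy hxy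
    have := aux_F_mono D hxy
    exact Real.log_le_log hy.2 (by linarith)
  set P := {x | 0 < 1 - D.F x} with hP
  have hmaxF : ∀ x, D.F (max x a) = D.F x := by
    intro x
    rcases le_total x a with h | h
    · rw [max_eq_right h, hFa a le_rfl, hFa x h]
    · rw [max_eq_left h]
  have hPconv : Convex ℝ P := by
    apply OrdConnected.convex
    constructor
    rintro x hx1 y hy1 z ⟨hz1, hz2⟩
    have := aux_F_mono D hz2
    have : 0 < 1 - D.F y := hy1
    show 0 < 1 - D.F z
    linarith
  refine ⟨hPconv, ?_⟩
  intro x hx y hy s t hs ht hst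
  have mV : ∀ x ∈ P, max x a ∈ V := by
    intro x hx
    refine ⟨(le_max_right x a : a ≤ max x a), ?_⟩
    show 0 < 1 - D.F (max x a)
    rw [hmaxF]; exact hx
  have h1 := hLc.2 (mV x hx) (mV y hy) hs ht hst
  have h2 := hLc.1 (mV x hx) (mV y hy) hs ht hst
  have h3 : max (s • x + t • y) a ≤ s • max x a + t • max y a := by
    simp only [smul_eq_mul]
    apply max_le
    · gcongr <;> exact le_max_left _ _
    · calc a = s * a + t * a := by rw [← add_mul, hst, one_mul]
        _ ≤ _ := by gcongr <;> exact le_max_right _ _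
  have h4 := hLa (mV _ (hPconv hx hy hs ht hst)) h2 h3
  simp only [hmaxF] at h1 h4
  exact h1.trans h4

lemma aux_bdd (D : ValueDist) (hMHR : D.IsMHR) : ∃ B, ∀ x, 0 ≤ x → x * (1 - D.F x) ≤ B := by
  have hconc := aux_conc D hMHR
  have h00 : D.F 0 = 0 := aux_F_zero D (fun y hy => D.supp_subset hy)
  obtain ⟨M, hM⟩ := ((aux_F_top D).eventually (lt_mem_nhds (by norm_num : (1/2:ℝ) < 1))).exists
  have hM0 : 0 ≤ M := by
    by_contra hcon
    push Not at hcon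
    have := aux_F_mono D hcon.le
    linarith
  obtain ⟨x0, hx0, hF⟩ := intermediate_value_Icc hM0 (aux_F_cont D).continuousOn
    (show (1/2:ℝ) ∈ Icc (D.F 0) (D.F M) from ⟨by rw [h00]; norm_num, hM.le⟩)
  have hx0p : 0 < x0 := by
    rcases hx0.1.eq_or_lt with h | h
    · rw [← h, h00] at hF; norm_num at hF
    · exact h
  have hl2 : 0 < Real.log 2 := Real.log_pos (by norm_num)
  refine ⟨max x0 (x0 / Real.log 2), fun x hx => ?_⟩
  have hle := aux_F_nonneg D x
  rcases le_total x x0 with h | h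
  · refine le_trans ?_ (le_max_left _ _)
    nlinarith
  refine le_trans ?_ (le_max_right _ _)
  have hxp : 0 < x := hx0p.trans_le h
  rcases (sub_nonneg.2 (aux_F_le_one D x)).eq_or_lt with hz | hz
  · rw [← hz, mul_zero]; positivity
  obtain ⟨_, c⟩ := aux_chord (S := fun x => 1 - D.F x) (p := 0) (x := x) (m := x0) (l := x0 / x) hconc
    (by rw [h00]; norm_num) hz (by positivity) (by rw [div_le_one hxp]; exact h) (by field_simp; ring)
  simp only [h00, hF, sub_zero, Real.log_one, mul_zero, zero_add] at c
  rw [show (1 - 1/2 : ℝ) = 2⁻¹ by norm_num, Real.log_inv] at c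
  have c2 : x * Real.log 2 ≤ - Real.log (1 - D.F x) * x0 := by
    have : x * (x0 / x * Real.log (1 - D.F x)) ≤ x * (-Real.log 2) := by gcongr
    have e : x * (x0 / x * Real.log (1 - D.F x)) = x0 * Real.log (1 - D.F x) := by field_simp
    linarith
  have c3 : - Real.log (1 - D.F x) * (1 - D.F x) ≤ 1 := by
    have := Real.add_one_le_exp (- Real.log (1 - D.F x))
    rw [Real.exp_neg, Real.exp_log hz] at this
    have h5 : - Real.log (1 - D.F x) ≤ (1 - D.F x)⁻¹ := by linarith
    calc _ ≤ (1 - D.F x)⁻¹ * (1 - D.F x) := by gcongr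
      _ = 1 := inv_mul_cancel₀ hz.ne'
  rw [le_div_iff₀ hl2]
  calc x * (1 - D.F x) * Real.log 2 = (x * Real.log 2) * (1 - D.F x) := by ring
    _ ≤ (- Real.log (1 - D.F x) * x0) * (1 - D.F x) := by gcongr
    _ = x0 * (- Real.log (1 - D.F x) * (1 - D.F x)) := by ring
    _ ≤ x0 * 1 := by gcongr
    _ = x0 := mul_one _

lemma aux_meas_Phi (r h : ℝ) : Measurable (auxPhi r h) := by
  have hp : Measurable (fun u : ℝ => (u / Real.exp (-h)) ^ (0.85:ℝ)) :=
    (measurable_id.div_const _).pow_const _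
  unfold auxPhi
  refine Measurable.ite measurableSet_Iic (hp.const_mul _) ?_
  refine Measurable.ite measurableSet_Iic (hp.const_mul _) ?_
  refine Measurable.ite measurableSet_Iic (hp.const_mul _) ?_
  refine Measurable.ite measurableSet_Iic measurable_const ?_
  exact (Real.measurable_log.neg.mul (measurable_id.pow_const _)).const_mul _

lemma aux_Phi_nonneg {r h u : ℝ} (hr : 0 < r) (hh : 0 ≤ h) (hu : 0 ≤ u) (hu1 : u ≤ 1) :
    0 ≤ auxPhi r h u := by
  have := Real.log_nonpos hu hu1
  have h2 : 0 ≤ -Real.log u := by linarith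
  unfold auxPhi
  split_ifs <;> positivity

/-- For every MHR value distribution `D`, the single-sample pricing strategy
`p(v) = 0.85 v` has expected revenue `E_{v∼D}[0.85 v (1 - F(0.85 v))]` at least
`0.589 · max_r r (1 - F r)`. -/
theorem mhr_single_sample_scaled_pricing (D : ValueDist) (hMHR : D.IsMHR) :
    ∀ r : ℝ,
      0.589 * (r * (1 - D.F r)) ≤ ∫ x, 0.85 * x * (1 - D.F (0.85 * x)) ∂D.μ := by
  intro r
  have := D.isProb
  have hS0 : ∀ x, 0 ≤ 1 - D.F x := fun x => sub_nonneg.2 (aux_F_le_one D x)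
  have hnn : 0 ≤ᵐ[D.μ] fun x => 0.85 * x * (1 - D.F (0.85 * x)) := by
    filter_upwards [aux_ae_nonneg D] with x hx
    have := hS0 (0.85 * x)
    simp only [Pi.zero_apply]
    positivity
  have hI := integral_nonneg_of_ae hnn
  rcases le_or_gt r 0 with hr | hr
  · have := mul_nonneg (neg_nonneg.2 hr) (hS0 r)
    linarith
  rcases (hS0 r).eq_or_lt with hz | hz
  · rw [← hz]; simpa using hI
  have h00 : D.F 0 = 0 := aux_F_zero D (fun y hy => D.supp_subset hy)
  set h := -Real.log (1 - D.F r) with hh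
  have hSr : 1 - D.F r = Real.exp (-h) := by rw [hh, neg_neg, Real.exp_log hz]
  have hh0 : 0 ≤ h := by
    have := Real.log_nonpos hz.le (by linarith [aux_F_nonneg D r])
    linarith
  have key := aux_integral_Phi hr hh0
  rw [← aux_integral_comp D _ (aux_meas_Phi r h), ← hSr] at key
  refine key.trans ?_
  apply integral_mono_of_nonneg
  · filter_upwards with x
    exact aux_Phi_nonneg hr hh0 (hS0 x) (by linarith [aux_F_nonneg D x])
  · obtain ⟨B, hB⟩ := aux_bdd D hMHR
    refine Integrable.of_bound (C := B) ?_ ?_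
    · have := aux_F_cont D
      exact (by fun_prop : Continuous fun x => 0.85 * x * (1 - D.F (0.85 * x))).aestronglyMeasurable
    · filter_upwards [hnn, aux_ae_nonneg D] with x hx hx0
      rw [Real.norm_of_nonneg hx]
      exact hB _ (by positivity)
  · filter_upwards [aux_ae_nonneg D, aux_ae_ne D 0, aux_ae_ne D (1 - D.F r)] with x hx h1 h2
    exact aux_pointwise (S := fun x => 1 - D.F x) (fun x y hxy => by
      have := aux_F_mono D hxy
      simp only; linarith) (by simp [h00]) (aux_conc D hMHR) hr hSr hx
      (lt_of_le_of_ne (hS0 x) (Ne.symm h1)) h2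
end

section
/- No deterministic single-sample pricing strategy is better than (e/4)-approximate for MHR distributions: for every function p : [0,∞) → [0,∞) and every γ > e/4, there exists an MHR value distribution D with CDF F such that E_{v∼D}[p(v)·(1 − F(p(v)))] < γ · max_r r·(1 − F(r)). -/
open MeasureTheory Set

/-- The exponential distribution with rate `l`. -/
noncomputable def expDist (l : ℝ) (hl : 0 < l) : ValueDist where
  μ := volume.withDensity fun x => ENNReal.ofReal (if 0 ≤ x then l * Real.exp (-(l * x)) else 0)
  isProb := by
    have h := ProbabilityTheory.lintegral_exponentialPDF_eq_one hl
    simp only [ProbabilityTheory.exponentialPDF_eq] at h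
    exact ⟨by rw [withDensity_apply _ MeasurableSet.univ, Measure.restrict_univ, h]⟩
  f := fun x => if 0 ≤ x then l * Real.exp (-(l * x)) else 0
  f_nonneg := fun x => by split_ifs <;> positivity
  f_meas := Measurable.ite measurableSet_Ici (by fun_prop) measurable_const
  density_eq := rfl
  supp := Ici 0
  supp_subset := subset_rfl
  supp_conn := ordConnected_Ici
  f_pos := fun x hx => by
    rw [if_pos (mem_Ici.1 hx)]; positivity
  f_zero := fun x hx => if_neg (by simpa using hx)

lemma expDist_F (l : ℝ) (hl : 0 < l) (x : ℝ) (hx : 0 ≤ x) :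
    (expDist l hl).F x = 1 - Real.exp (-(l * x)) := by
  have h := ProbabilityTheory.lintegral_exponentialPDF_eq_antiDeriv hl x
  simp only [ProbabilityTheory.exponentialPDF_eq] at h
  have h1 : Real.exp (-(l * x)) ≤ 1 := Real.exp_le_one_iff.2 (by nlinarith)
  rw [ValueDist.F, expDist]
  simp only
  rw [withDensity_apply _ measurableSet_Iic, h, if_pos hx, ENNReal.toReal_ofReal (by linarith)]

lemma expDist_mhr (l : ℝ) (hl : 0 < l) : (expDist l hl).IsMHR := by
  have key : ∀ y ∈ Ici (0:ℝ), (expDist l hl).phi y = y - 1 / l := by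
    intro y hy
    have hy' : (0:ℝ) ≤ y := hy
    rw [ValueDist.phi, expDist_F l hl y hy']
    have : (expDist l hl).f y = l * Real.exp (-(l * y)) := if_pos hy'
    rw [this]
    have := Real.exp_pos (-(l * y))
    field_simp
    ring
  intro x hx
  refine ⟨1, le_rfl, ?_⟩
  have h : HasDerivWithinAt (fun y : ℝ => y - 1 / l) 1 (Ici 0) x :=
    ((hasDerivAt_id x).sub_const _).hasDerivWithinAt
  exact h.congr key (key x hx)

lemma expDist_integral (l : ℝ) (hl : 0 < l) (p : ℝ → ℝ) (hp' : ∀ v, 0 ≤ v → 0 ≤ p v) :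
    ∫ x, p x * (1 - (expDist l hl).F (p x)) ∂(expDist l hl).μ
      = ∫ v in Ioi (0:ℝ), l * p v * Real.exp (-(l * (p v + v))) := by
  have hm := (expDist l hl).f_meas
  rw [(expDist l hl).density_eq, integral_withDensity_eq_integral_toReal_smul
    (by fun_prop) (by simp), ← integral_Ici_eq_integral_Ioi,
    ← integral_indicator measurableSet_Ici]
  congr 1
  ext x
  rw [ENNReal.toReal_ofReal ((expDist l hl).f_nonneg x)]
  by_cases hx : 0 ≤ x
  · rw [indicator_of_mem (mem_Ici.2 hx), expDist_F l hl _ (hp' x hx)]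
    have : (expDist l hl).f x = l * Real.exp (-(l * x)) := if_pos hx
    rw [this, mul_add, neg_add, Real.exp_add, smul_eq_mul]
    ring
  · rw [indicator_of_notMem (by simpa using hx)]
    have : (expDist l hl).f x = 0 := if_neg hx
    rw [this]; simp

lemma xexp_le_one (y : ℝ) : y * Real.exp (-y) ≤ 1 := by
  have h := Real.add_one_le_exp y
  rw [Real.exp_neg, ← div_eq_mul_inv, div_le_one (Real.exp_pos y)]
  linarith

/-- pointwise bound -/
lemma integrand_le (l q v : ℝ) :
    l * q * Real.exp (-(l * (q + v))) ≤ Real.exp (-(l * v)) := by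
  have h := xexp_le_one (l * q)
  rw [mul_add, neg_add, Real.exp_add, ← mul_assoc]
  exact mul_le_of_le_one_left (Real.exp_pos _).le h

lemma inner_mid (b q v : ℝ) (hb : 1 ≤ b) (hq : 0 ≤ q) (hv : 0 < v) :
    ∫ l in (1:ℝ)..b, l * q * Real.exp (-(l * (q + v))) ≤ 1 / 4 * (1 / v) := by
  have hs : 0 < q + v := by linarith
  set s := q + v with hsdef
  have hd : ∀ l ∈ uIcc 1 b, HasDerivAt
      (fun l : ℝ => -(q * (l / s + 1 / s ^ 2) * Real.exp (-(l * s))))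
      (l * q * Real.exp (-(l * s))) l := by
    intro l _
    have h1 : HasDerivAt (fun l : ℝ => Real.exp (-(l * s))) (Real.exp (-(l * s)) * (-(1 * s))) l :=
      (((hasDerivAt_id l).mul_const s).neg).exp
    have h2 : HasDerivAt (fun l : ℝ => q * (l / s + 1 / s ^ 2)) (q * (1 / s)) l :=
      (((hasDerivAt_id l).div_const s).add_const _).const_mul q
    refine ((h2.mul h1).neg).congr_deriv ?_
    field_simp
    ring
  rw [intervalIntegral.integral_eq_sub_of_hasDerivAt hd
    (Continuous.intervalIntegrable (by fun_prop) _ _)]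
  have e1 : 0 ≤ q * (b / s + 1 / s ^ 2) * Real.exp (-(b * s)) := by positivity
  have e2 : (1 / s + 1 / s ^ 2) * Real.exp (-(1 * s)) ≤ 1 / s ^ 2 := by
    have h := Real.add_one_le_exp s
    rw [one_mul, Real.exp_neg, ← div_eq_mul_inv, div_le_iff₀ (Real.exp_pos s)]
    have : 1 / s + 1 / s ^ 2 = 1 / s ^ 2 * (s + 1) := by field_simp
    rw [this]
    gcongr
  have e3 : q * (1 / s ^ 2) ≤ 1 / 4 * (1 / v) := by
    have h4 : 1 / 4 * (1 / v) = 1 / (4 * v) := by field_simp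
    rw [h4, mul_one_div, div_le_div_iff₀ (by positivity) (by positivity)]
    nlinarith [sq_nonneg (q - v)]
  have e4 := mul_le_mul_of_nonneg_left e2 hq
  nlinarith

lemma inner_small (b q v : ℝ) (hb : 1 ≤ b) (hv : 0 ≤ v) :
    ∫ l in (1:ℝ)..b, l * q * Real.exp (-(l * (q + v))) ≤ b := by
  calc _ ≤ ∫ l in (1:ℝ)..b, (1:ℝ) := by
        refine intervalIntegral.integral_mono_on hb
          (Continuous.intervalIntegrable (by fun_prop) _ _)
          (Continuous.intervalIntegrable (by fun_prop) _ _) fun l hl => ?_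
        refine (integrand_le l q v).trans (Real.exp_le_one_iff.2 ?_)
        have := hl.1
        have : 0 ≤ l * v := by positivity
        linarith
    _ ≤ b := by simp

lemma inner_large (b q v : ℝ) (hb : 1 ≤ b) (hv : 1 ≤ v) :
    ∫ l in (1:ℝ)..b, l * q * Real.exp (-(l * (q + v))) ≤ Real.exp (-v) := by
  calc _ ≤ ∫ l in (1:ℝ)..b, Real.exp (-(l * v)) * v := by
        refine intervalIntegral.integral_mono_on hb
          (Continuous.intervalIntegrable (by fun_prop) _ _)
          (Continuous.intervalIntegrable (by fun_prop) _ _) fun l hl => ?_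
        refine (integrand_le l q v).trans ?_
        exact le_mul_of_one_le_right (Real.exp_pos _).le hv
    _ = -Real.exp (-(b * v)) - -Real.exp (-(1 * v)) := by
        refine intervalIntegral.integral_eq_sub_of_hasDerivAt
          (f := fun l : ℝ => -Real.exp (-(l * v))) ?_
          (Continuous.intervalIntegrable (by fun_prop) _ _)
        intro l _
        have h1 : HasDerivAt (fun l : ℝ => Real.exp (-(l * v)))
          (Real.exp (-(l * v)) * (-(1 * v))) l :=
          (((hasDerivAt_id l).mul_const v).neg).exp
        exact h1.neg.congr_deriv (by ring)
    _ ≤ _ := by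
        have := Real.exp_pos (-(b * v))
        rw [one_mul]; linarith

lemma main_bound (p : ℝ → ℝ) (hp : Measurable p) (hp' : ∀ v, 0 ≤ v → 0 ≤ p v)
    (b c : ℝ) (hb : 1 ≤ b)
    (H : ∀ l : ℝ, 0 < l → c * (1 / l) ≤ ∫ v in Ioi (0:ℝ), l * p v * Real.exp (-(l * (p v + v)))) :
    c * Real.log b ≤ 2 + 1 / 4 * Real.log b := by
  have hb0 : 0 < b := by linarith
  have hint : Integrable (Function.uncurry fun l v : ℝ => l * p v * Real.exp (-(l * (p v + v))))
      ((volume.restrict (uIoc 1 b)).prod (volume.restrict (Ioi (0:ℝ)))) := by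
    have hg : Integrable (fun z : ℝ × ℝ => (1:ℝ) * Real.exp (-z.2))
        ((volume.restrict (uIoc 1 b)).prod (volume.restrict (Ioi (0:ℝ)))) := by
      refine Integrable.mul_prod (f := fun _ : ℝ => (1:ℝ)) (g := fun v : ℝ => Real.exp (-v)) ?_ ?_
      · rw [uIoc_of_le hb]; exact integrable_const _
      · have h := exp_neg_integrableOn_Ioi 0 one_pos
        simp only [neg_mul, one_mul] at h
        exact h
    refine hg.mono' (Measurable.aestronglyMeasurable ?_) ?_
    · unfold Function.uncurry; fun_prop
    · rw [Measure.prod_restrict]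
      refine (ae_restrict_iff' (measurableSet_uIoc.prod measurableSet_Ioi)).2 (.of_forall ?_)
      rintro ⟨l, v⟩ ⟨h1, h2⟩
      rw [uIoc_of_le hb] at h1
      simp only [mem_Ioc, mem_Ioi] at h1 h2
      have := hp' v h2.le
      have hl : 0 < l := by linarith
      simp only [Function.uncurry]
      rw [Real.norm_of_nonneg (by positivity), one_mul]
      refine (integrand_le l _ v).trans (Real.exp_le_exp.2 ?_)
      nlinarith
  have swap := intervalIntegral_integral_swap hint
  have hJ := hint.integral_prod_right
  have hG := hint.integral_prod_left
  simp only [Function.uncurry] at hJ hG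
  have hJ' : IntegrableOn
      (fun v => ∫ l in (1:ℝ)..b, l * p v * Real.exp (-(l * (p v + v)))) (Ioi 0) := by
    simp only [intervalIntegral.integral_of_le hb]
    rw [uIoc_of_le hb] at hJ
    exact hJ
  have lower : c * Real.log b ≤
      ∫ l in (1:ℝ)..b, ∫ v in Ioi (0:ℝ), l * p v * Real.exp (-(l * (p v + v))) := by
    calc c * Real.log b = ∫ l in (1:ℝ)..b, c * (1 / l) := by
          rw [intervalIntegral.integral_const_mul, integral_one_div_of_pos one_pos hb0, div_one]
      _ ≤ _ := by
          refine intervalIntegral.integral_mono_on hb ?_ ?_ fun l hl => H l (by linarith [hl.1])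
          · refine ContinuousOn.intervalIntegrable ?_
            rw [uIcc_of_le hb]
            refine continuousOn_const.mul (continuousOn_const.div continuousOn_id fun x hx => ?_)
            have := hx.1
            exact ne_of_gt (show (0:ℝ) < x by linarith)
          · rw [intervalIntegrable_iff]; exact hG
  rw [swap] at lower
  refine lower.trans ?_
  have hib : 0 < 1 / b := by positivity
  have hib1 : 1 / b ≤ 1 := by rw [div_le_one hb0]; exact hb
  have hs1 : Ioc 0 (1 / b) ⊆ Ioi (0:ℝ) := fun x hx => hx.1
  have hs2 : Ioc (1 / b) 1 ⊆ Ioi (0:ℝ) := fun x hx => hib.trans hx.1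
  have hs3 : Ioi 1 ⊆ Ioi (0:ℝ) := fun x hx => lt_trans one_pos (mem_Ioi.1 hx)
  have hs4 : Ioc 0 1 ⊆ Ioi (0:ℝ) := fun x hx => hx.1
  rw [← Ioc_union_Ioi_eq_Ioi (zero_le_one' ℝ), setIntegral_union (Ioc_disjoint_Ioi le_rfl)
    measurableSet_Ioi (hJ'.mono_set hs4) (hJ'.mono_set hs3),
    ← Ioc_union_Ioc_eq_Ioc hib.le hib1, setIntegral_union (Ioc_disjoint_Ioc_of_le le_rfl)
    measurableSet_Ioc (hJ'.mono_set hs1) (hJ'.mono_set hs2)]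
  have b1 : ∫ v in Ioc 0 (1 / b), ∫ l in (1:ℝ)..b, l * p v * Real.exp (-(l * (p v + v))) ≤ 1 := by
    calc _ ≤ ∫ v in Ioc 0 (1 / b), b :=
          setIntegral_mono_on (hJ'.mono_set hs1) (by simp) measurableSet_Ioc
            fun v hv => inner_small b _ v hb hv.1.le
      _ = 1 := by
          rw [← intervalIntegral.integral_of_le hib.le]; simp; field_simp
  have b2 : ∫ v in Ioc (1 / b) 1, ∫ l in (1:ℝ)..b, l * p v * Real.exp (-(l * (p v + v)))
      ≤ 1 / 4 * Real.log b := by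
    calc _ ≤ ∫ v in Ioc (1 / b) 1, 1 / 4 * (1 / v) := by
          refine setIntegral_mono_on (hJ'.mono_set hs2) ?_ measurableSet_Ioc
            fun v hv => inner_mid b _ v hb (hp' v (hs2 hv).le) (hs2 hv)
          rw [← intervalIntegrable_iff_integrableOn_Ioc_of_le hib1]
          refine ContinuousOn.intervalIntegrable ?_
          rw [uIcc_of_le hib1]
          refine continuousOn_const.mul (continuousOn_const.div continuousOn_id fun x hx => ?_)
          have := hx.1
          exact ne_of_gt (show (0:ℝ) < x by linarith)
      _ = _ := by
          rw [← intervalIntegral.integral_of_le hib1, intervalIntegral.integral_const_mul,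
            integral_one_div_of_pos hib one_pos, one_div_one_div]
  have b3 : ∫ v in Ioi 1, ∫ l in (1:ℝ)..b, l * p v * Real.exp (-(l * (p v + v))) ≤ 1 := by
    calc _ ≤ ∫ v in Ioi (1:ℝ), Real.exp (-v) :=
          setIntegral_mono_on (hJ'.mono_set hs3)
            (by simpa using exp_neg_integrableOn_Ioi 1 one_pos) measurableSet_Ioi
            fun v hv => inner_large b _ v hb (le_of_lt hv)
      _ ≤ 1 := by
          rw [integral_exp_neg_Ioi]; exact Real.exp_le_one_iff.2 (by norm_num)
  linarith

/-- No deterministic single-sample pricing strategy is better than `e/4`-approximate for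
MHR distributions: for every pricing function `p : [0,∞) → [0,∞)` and every `γ > e/4`
there is an MHR value distribution `D` whose expected revenue
`E_{v∼D}[p(v)(1 - F(p(v)))]` is less than `γ` times the revenue of some price
(and hence less than `γ · R*`). -/
theorem mhr_single_sample_lower_bound
    (p : ℝ → ℝ) (hp : Measurable p) (hp' : ∀ v, 0 ≤ v → 0 ≤ p v)
    (γ : ℝ) (hγ : Real.exp 1 / 4 < γ) :
    ∃ D : ValueDist, D.IsMHR ∧
      ∃ r : ℝ, ∫ x, p x * (1 - D.F (p x)) ∂D.μ < γ * (r * (1 - D.F r)) := by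
  by_contra! hcon
  have he := Real.exp_pos 1
  set c := γ / Real.exp 1 with hc
  have hc4 : 0 < c - 1 / 4 := by
    have : Real.exp 1 / 4 / Real.exp 1 < γ / Real.exp 1 := by gcongr
    have h2 : Real.exp 1 / 4 / Real.exp 1 = 1 / 4 := by field_simp
    linarith
  have H : ∀ l : ℝ, 0 < l →
      c * (1 / l) ≤ ∫ v in Ioi (0:ℝ), l * p v * Real.exp (-(l * (p v + v))) := by
    intro l hl
    have h := hcon (expDist l hl) (expDist_mhr l hl) (1 / l)
    rw [expDist_integral l hl p hp', expDist_F l hl _ (by positivity), mul_one_div_cancel hl.ne',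
      Real.exp_neg] at h
    have e : c * (1 / l) = γ * (1 / l * (1 - (1 - (Real.exp 1)⁻¹))) := by
      rw [hc]; ring
    rw [e]; exact h
  have hb : 0 ≤ 3 / (c - 1 / 4) := by positivity
  have hM := main_bound p hp hp' (Real.exp (3 / (c - 1 / 4))) c (Real.one_le_exp hb) H
  rw [Real.log_exp] at hM
  have : (c - 1 / 4) * (3 / (c - 1 / 4)) = 3 := mul_div_cancel₀ _ hc4.ne'
  linarith
end
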